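/- Write m = 3^α m', n = 3^β n' with 3 ∤ m'n'. If α > β, then a₀^{(9)}(m,n) ≡ 0 (mod 3^{3(α−β)+3}); if β > α, then a₀^{(9)}(m,n) ≡ 0 (mod 3^{2(β−α)+3}). -/

import Mathlib

open scoped Manifold
open Complex UpperHalfPlane ModularForm Matrix MatrixGroups

noncomputable def qq (z : ℂ) : ℂ := Complex.exp (2 * Real.pi * Complex.I * z)

noncomputable def dedekindEta (z : ℂ) : ℂ :=
  Complex.exp (Real.pi * Complex.I * z / 12) * ∏' n : ℕ, (1 - qq ((n + 1) * z))

/-- `f` is a weakly holomorphic modular form of weight `k` on `Γ₀(N)`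
whose only possible pole among the cusps is at `∞`. -/
def IsWeaklyHolomorphicSharp (k : ℤ) (N : ℕ) (f : ℍ → ℂ) : Prop :=
  MDifferentiable 𝓘(ℂ) 𝓘(ℂ) f ∧
  (∀ γ ∈ CongruenceSubgroup.Gamma0 N, f ∣[k] γ = f) ∧
  (∀ γ : SL(2, ℤ), ∃ M : ℕ,
    UpperHalfPlane.IsBoundedAtImInfty (fun z => qq z ^ M * (f ∣[k] γ) z)) ∧
  (∀ γ : SL(2, ℤ), ¬ ((N : ℤ) ∣ (γ : Matrix (Fin 2) (Fin 2) ℤ) 1 0) →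
    UpperHalfPlane.IsBoundedAtImInfty (f ∣[k] γ))

/-- `f` additionally vanishes at every cusp other than `∞`. -/
def IsWeaklyHolomorphicSharpCusp (k : ℤ) (N : ℕ) (f : ℍ → ℂ) : Prop :=
  IsWeaklyHolomorphicSharp k N f ∧
  (∀ γ : SL(2, ℤ), ¬ ((N : ℤ) ∣ (γ : Matrix (Fin 2) (Fin 2) ℤ) 1 0) →
    UpperHalfPlane.IsZeroAtImInfty (f ∣[k] γ))

/-- `f` is the canonical basis element `f_{0,m}^{(N)}` with coefficients `a`. -/
def IsCanonicalBasis0 (N : ℕ) (m : ℕ) (f : ℍ → ℂ) (a : ℕ → ℤ) : Prop :=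
  IsWeaklyHolomorphicSharp 0 N f ∧
  ∀ z : ℍ, f z = qq z ^ (-(m : ℤ)) + ∑' n : ℕ, (a (n + 1) : ℂ) * qq z ^ ((n : ℕ) + 1)

noncomputable def Uop (p : ℕ) (f : ℍ → ℂ) : ℍ → ℂ := fun z =>
  (p : ℂ)⁻¹ * ∑ j ∈ Finset.range p, f (((j : ℝ) / p) +ᵥ z)

noncomputable def Vop (p : ℕ) (f : ℍ → ℂ) : ℍ → ℂ := fun z =>
  if h : 0 < p then
    f ⟨p * z, by simpa using mul_pos (by exact_mod_cast h : (0:ℝ) < p) z.2⟩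
  else 0

/-- `F` is the `q`-expansion of `f`, convergent on the whole upper half-plane. -/
def QExp (f : ℍ → ℂ) (F : LaurentSeries ℂ) : Prop :=
  ∀ z : ℍ, HasSum (fun n : ℤ => F.coeff n * qq z ^ n) (f z)

lemma qq_ne_zero (z : ℂ) : qq z ≠ 0 := Complex.exp_ne_zero _

lemma qq_eq_qParam (z : ℂ) : qq z = Function.Periodic.qParam 1 z := by
  simp [qq, Function.Periodic.qParam]

lemma norm_qq (z : ℂ) : ‖qq z‖ = Real.exp (-2 * Real.pi * z.im) := by
  rw [qq_eq_qParam, Function.Periodic.norm_qParam, div_one]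

lemma qq_tendsto : Filter.Tendsto (fun z : ℍ => qq z) atImInfty (nhds 0) := by
  simpa only [qq_eq_qParam] using qParam_tendsto_atImInfty one_pos

namespace QExp

variable {f g : ℍ → ℂ} {F G : LaurentSeries ℂ}

lemma add (hf : QExp f F) (hg : QExp g G) : QExp (fun z => f z + g z) (F + G) := fun z => by
  simpa [add_mul] using (hf z).add (hg z)

lemma sub (hf : QExp f F) (hg : QExp g G) : QExp (fun z => f z - g z) (F - G) := fun z => by
  simpa [sub_mul] using (hf z).sub (hg z)

lemma single (k : ℤ) (c : ℂ) : QExp (fun z => c * qq z ^ k) (HahnSeries.single k c) := fun z => by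
  convert hasSum_single (f := fun n : ℤ => (HahnSeries.single k c).coeff n * qq z ^ n) k ?_ using 1
  · simp
  · intro n hn
    simp [HahnSeries.coeff_single_of_ne hn]

lemma const (c : ℂ) : QExp (fun _ => c) (HahnSeries.C c) := by
  simpa using! QExp.single 0 c

lemma mul (hf : QExp f F) (hg : QExp g G) : QExp (fun z => f z * g z) (F * G) := fun z => by
  have hs := summable_mul_of_summable_norm (hf z).summable.norm (hg z).summable.norm
  have h := (hf z).mul (hg z) hs
  let e : ℤ × ℤ ≃ ℤ × ℤ :=
    ⟨fun p => (p.2, p.1 - p.2), fun p => (p.1 + p.2, p.1), fun p => by simp, fun p => by simp⟩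
  rw [← e.hasSum_iff] at h
  refine h.prod_fiberwise fun n => ?_
  have hq := qq_ne_zero z
  rw [HahnSeries.coeff_mul, Finset.sum_mul]
  have hinj : Set.InjOn Prod.fst
      (Finset.antidiagonal F.isPWO_support G.isPWO_support n : Set (ℤ × ℤ)) := by
    intro a ha b hb hab
    rw [Finset.mem_coe, Finset.mem_antidiagonal] at ha hb
    ext
    · exact hab
    · linarith [ha.2.2, hb.2.2, show a.1 = b.1 from hab]
  have key := hasSum_sum_of_ne_finset_zero (L := SummationFilter.unconditional ℤ)
    (f := fun i : ℤ => F.coeff i * G.coeff (n - i) * qq z ^ n)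
    (s := (Finset.antidiagonal F.isPWO_support G.isPWO_support n).image Prod.fst) ?_
  · rw [Finset.sum_image hinj] at key
    have hfun : (fun c => ((fun x : ℤ × ℤ => F.coeff x.1 * qq z ^ x.1 * (G.coeff x.2 * qq z ^ x.2)) ∘
        e) (n, c)) = fun i => F.coeff i * G.coeff (n - i) * qq z ^ n := by
      ext i
      simp only [e, Function.comp, Equiv.coe_fn_mk]
      rw [mul_mul_mul_comm, ← zpow_add₀ hq, add_sub_cancel]
    have hsum : ∀ p ∈ Finset.antidiagonal F.isPWO_support G.isPWO_support n,
        F.coeff p.1 * G.coeff p.2 * qq z ^ n = F.coeff p.1 * G.coeff (n - p.1) * qq z ^ n := by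
      intro p hp
      rw [Finset.mem_antidiagonal] at hp
      rw [show n - p.1 = p.2 by linarith [hp.2.2]]
    rw [hfun, Finset.sum_congr rfl hsum]
    exact key
  · intro i hi
    by_contra hne
    apply hi
    rw [Finset.mem_image]
    refine ⟨(i, n - i), ?_, rfl⟩
    rw [Finset.mem_antidiagonal]
    refine ⟨?_, ?_, by simp⟩
    · rw [HahnSeries.mem_support]; intro h0; simp [h0] at hne
    · rw [HahnSeries.mem_support]; intro h0; simp [h0] at hne

lemma pow (hf : QExp f F) (n : ℕ) : QExp (fun z => f z ^ n) (F ^ n) := by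
  induction n with
  | zero => simpa using! const 1
  | succ n ih => simpa only [pow_succ] using ih.mul hf

lemma congr (hf : QExp f F) (h : ∀ z, g z = f z) (hF : G = F) : QExp g G := by
  subst hF; intro z; rw [h]; exact hf z

lemma aeval (hf : QExp f F) (p : Polynomial ℤ) :
    QExp (fun z => Polynomial.aeval (f z) p) (Polynomial.aeval F p) := by
  induction p using Polynomial.induction_on' with
  | add p r hp hr => exact (hp.add hr).congr (fun z => by simp) (by simp)
  | monomial n a =>
    refine ((const (a : ℂ)).mul (hf.pow n)).congr (fun z => ?_) ?_
    · simp [Polynomial.aeval_monomial]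
    · simp [Polynomial.aeval_monomial]

lemma bounded (hf : QExp f F) (h0 : ∀ n < 0, F.coeff n = 0) : IsBoundedAtImInfty f := by
  refine isBoundedAtImInfty_of_hasSum_qExpansion (c := fun n => F.coeff n) one_pos fun z => ?_
  have h := hf z
  rw [← Function.Injective.hasSum_iff (g := fun n : ℕ => (n : ℤ)) Nat.cast_injective] at h
  · simpa [Function.comp_def, qq_eq_qParam] using h
  · intro n hn
    rw [h0 n, zero_mul]
    by_contra! h
    exact hn ⟨n.toNat, Int.toNat_of_nonneg h⟩

lemma tendsto (hf : QExp f F) (h0 : ∀ n < 0, F.coeff n = 0) :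
    Filter.Tendsto f atImInfty (nhds (F.coeff 0)) := by
  have hb := ((single (-1) 1).mul (hf.sub (const (F.coeff 0)))).bounded (fun n hn => by
    rw [HahnSeries.coeff_single_mul, sub_neg_eq_add]
    rcases lt_or_eq_of_le (show n + 1 ≤ 0 by omega) with h | h
    · simp [h0 _ h, HahnSeries.C_apply, HahnSeries.coeff_single_of_ne h.ne]
    · simp [h])
  have h1 := qq_tendsto.zero_mul_isBoundedUnder_le hb.isBoundedUnder_le
  have h2 := h1.add_const (F.coeff 0)
  rw [zero_add] at h2
  refine h2.congr fun z => ?_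
  have := qq_ne_zero z
  simp only [_root_.zpow_neg_one, one_mul]
  field_simp
  ring

lemma unique (hf : QExp f F) (hg : QExp f G) : F = G := by
  by_contra hne
  have hFG : F - G ≠ 0 := sub_ne_zero.2 hne
  have h := ((single (-(F - G).order) 1).mul (hf.sub hg))
  have hc : ∀ n, (HahnSeries.single (-(F - G).order) (1 : ℂ) * (F - G)).coeff n =
      (F - G).coeff (n + (F - G).order) := fun n => by
    rw [HahnSeries.coeff_single_mul, one_mul, sub_neg_eq_add]
  have ht := h.tendsto (fun n hn => by
    rw [hc]; exact HahnSeries.coeff_eq_zero_of_lt_order (by omega))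
  rw [hc, zero_add] at ht
  simp only [sub_self, mul_zero] at ht
  exact HahnSeries.coeff_order_eq_zero.not.2 hFG (tendsto_nhds_unique tendsto_const_nhds ht).symm

lemma funext (hf : QExp f F) (hg : QExp g F) : f = g := by
  ext z; exact (hf z).unique (hg z)

lemma ofPowerSeries {P : PowerSeries ℂ}
    (h : ∀ z : ℍ, HasSum (fun n : ℕ => P.coeff n * qq z ^ n) (f z)) :
    QExp f (HahnSeries.ofPowerSeries ℤ ℂ P) := fun z => by
  rw [← Function.Injective.hasSum_iff (g := fun n : ℕ => (n : ℤ)) Nat.cast_injective]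
  · simpa [Function.comp_def, HahnSeries.ofPowerSeries_apply_coeff] using h z
  · intro n hn
    have : (HahnSeries.ofPowerSeries ℤ ℂ P).coeff n = 0 := by
      rw [HahnSeries.ofPowerSeries_apply]
      exact HahnSeries.embDomain_of_notMem_range (by simpa using hn)
    rw [this, zero_mul]

lemma ofHolomorphic (hper : ∀ z, f ((1 : ℝ) +ᵥ z) = f z) (hd : MDifferentiable 𝓘(ℂ) 𝓘(ℂ) f)
    (hb : IsBoundedAtImInfty f) :
    QExp f (HahnSeries.ofPowerSeries ℤ ℂ (qExpansion 1 f)) := by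
  refine ofPowerSeries fun z => ?_
  have h := hasSum_qExpansion one_pos (f := f) ?_ hd hb z
  · simpa [qq_eq_qParam] using h
  · intro w
    simp only [Function.comp]
    by_cases hw : 0 < w.im
    · have h1 := hper ⟨w, hw⟩
      rw [ofComplex_apply_of_im_pos hw, ofComplex_apply_of_im_pos (by simpa using hw), ← h1]
      congr 1
      ext
      simp [add_comm]
    · rw [ofComplex_apply_of_im_nonpos (by simpa using hw),
        ofComplex_apply_of_im_nonpos (by simpa using hw)]

end QExp

/-- Laurent series all of whose coefficients are rational integers. -/
def intSeries : Subring (LaurentSeries ℂ) where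
  carrier := {F | ∀ n, F.coeff n ∈ (Int.castRingHom ℂ).range}
  mul_mem' {F G} hF hG n := by
    rw [HahnSeries.coeff_mul]
    exact Subring.sum_mem _ fun p _ => mul_mem (hF _) (hG _)
  one_mem' n := by
    rw [HahnSeries.coeff_one]; split_ifs <;> simp
  add_mem' hF hG n := by
    rw [HahnSeries.coeff_add]; exact add_mem (hF n) (hG n)
  zero_mem' n := by simp
  neg_mem' hF n := by
    rw [HahnSeries.coeff_neg]; exact neg_mem (hF n)

lemma mem_intSeries {F : LaurentSeries ℂ} : F ∈ intSeries ↔ ∀ n, ∃ k : ℤ, (k : ℂ) = F.coeff n :=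
  Iff.rfl

lemma single_mem_intSeries (k : ℤ) (a : ℤ) : HahnSeries.single k (a : ℂ) ∈ intSeries := fun n => by
  rw [HahnSeries.coeff_single]; split_ifs <;> simp

/-- A fixed point of `H ↦ A + B * H` with `A`, `B` integral and `B = O(q)` is integral. -/
lemma mem_intSeries_of_eq_add_mul {A B H : LaurentSeries ℂ} (hA : A ∈ intSeries)
    (hB : B ∈ intSeries) (hB0 : ∀ n < 1, B.coeff n = 0) (h : H = A + B * H) : H ∈ intSeries := by
  have key : ∀ k : ℕ, ∀ n : ℤ, n < H.order + k → H.coeff n ∈ (Int.castRingHom ℂ).range := by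
    intro k
    induction k with
    | zero =>
      intro n hn
      rw [HahnSeries.coeff_eq_zero_of_lt_order (by simpa using hn)]
      exact zero_mem _
    | succ k ih =>
      intro n hn
      rw [h, HahnSeries.coeff_add, HahnSeries.coeff_mul]
      refine add_mem (hA n) (Subring.sum_mem _ fun p hp => ?_)
      rw [Finset.mem_antidiagonal] at hp
      have h1 : ¬ p.1 < 1 := fun hlt => hp.1 (hB0 _ hlt)
      refine mul_mem (hB _) (ih _ ?_)
      push_cast at hn
      have := hp.2.2
      omega
  intro n
  refine key (n - H.order + 1).toNat n ?_
  have := Int.self_le_toNat (n - H.order + 1)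
  omega

/-- The operator `q d/dq`. -/
def thetaD (F : LaurentSeries ℂ) : LaurentSeries ℂ where
  coeff n := n * F.coeff n
  isPWO_support' := F.isPWO_support.mono fun n hn h0 => hn (by simp [h0])

lemma coeff_thetaD (F : LaurentSeries ℂ) (n : ℤ) : (thetaD F).coeff n = n * F.coeff n := rfl

lemma thetaD_mul (F G : LaurentSeries ℂ) : thetaD (F * G) = thetaD F * G + F * thetaD G := by
  ext n
  have hF : (thetaD F).support ⊆ F.support := fun n hn h0 => hn (by simp [coeff_thetaD, h0])
  have hG : (thetaD G).support ⊆ G.support := fun n hn h0 => hn (by simp [coeff_thetaD, h0])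
  rw [HahnSeries.coeff_add, HahnSeries.coeff_mul_left' F.isPWO_support hF,
    HahnSeries.coeff_mul_right' G.isPWO_support hG, coeff_thetaD, HahnSeries.coeff_mul,
    Finset.mul_sum, ← Finset.sum_add_distrib]
  refine Finset.sum_congr rfl fun p hp => ?_
  rw [Finset.mem_antidiagonal] at hp
  rw [coeff_thetaD, coeff_thetaD, ← hp.2.2]
  push_cast
  ring

lemma thetaD_add (F G : LaurentSeries ℂ) : thetaD (F + G) = thetaD F + thetaD G := by
  ext n; simp [coeff_thetaD, mul_add]

lemma thetaD_one : thetaD 1 = 0 := by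
  ext n
  rw [coeff_thetaD, HahnSeries.coeff_one]
  split_ifs with h <;> simp [h]

lemma thetaD_pow_succ (F : LaurentSeries ℂ) (n : ℕ) :
    thetaD (F ^ (n + 1)) = (n + 1) * F ^ n * thetaD F := by
  induction n with
  | zero => simp
  | succ n ih => rw [pow_succ, thetaD_mul, ih]; push_cast; ring

lemma coeff_intCast_mul (a : ℤ) (F : LaurentSeries ℂ) (k : ℤ) :
    ((a : LaurentSeries ℂ) * F).coeff k = a * F.coeff k := by
  rw [← map_intCast (HahnSeries.C : ℂ →+* LaurentSeries ℂ), HahnSeries.C_mul_eq_smul]; simp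

lemma thetaD_intCast_mul (a : ℤ) (F : LaurentSeries ℂ) :
    thetaD ((a : LaurentSeries ℂ) * F) = a * thetaD F := by
  ext n
  rw [coeff_intCast_mul, coeff_thetaD, coeff_thetaD, coeff_intCast_mul]
  ring

lemma coeff_zero_pow_mul_thetaD (F : LaurentSeries ℂ) (n : ℕ) :
    (F ^ n * thetaD F).coeff 0 = 0 := by
  have h : (thetaD (F ^ (n + 1))).coeff 0 = 0 := by simp [coeff_thetaD]
  rw [thetaD_pow_succ, mul_assoc, show (n : LaurentSeries ℂ) + 1 = ((n + 1 : ℤ) : LaurentSeries ℂ) by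
    push_cast; rfl, coeff_intCast_mul] at h
  exact (mul_eq_zero.1 h).resolve_left (by exact_mod_cast n.succ_ne_zero)

/-- The residue pairing `(F, G) ↦ coeff₀ (F * q dG/dq)` vanishes on `ℤ[F]`. -/
lemma coeff_zero_aeval_mul_thetaD_aeval (F : LaurentSeries ℂ) (p r : Polynomial ℤ) :
    (Polynomial.aeval F p * thetaD (Polynomial.aeval F r)).coeff 0 = 0 := by
  induction r using Polynomial.induction_on' with
  | add r s hr hs => simp only [map_add, thetaD_add, mul_add, HahnSeries.coeff_add, hr, hs, add_zero]
  | monomial n b =>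
    induction p using Polynomial.induction_on' with
    | add p s hp hs => simp only [map_add, add_mul, HahnSeries.coeff_add, hp, hs, add_zero]
    | monomial m a =>
      simp only [Polynomial.aeval_monomial, eq_intCast, thetaD_intCast_mul]
      rw [mul_mul_mul_comm, ← Int.cast_mul, coeff_intCast_mul]
      cases n with
      | zero => simp [thetaD_one]
      | succ n =>
        rw [thetaD_pow_succ, show F ^ m * ((n + 1) * F ^ n * thetaD F) =
          ((n + 1 : ℤ) : LaurentSeries ℂ) * (F ^ (m + n) * thetaD F) by push_cast; ring,
          coeff_intCast_mul, coeff_zero_pow_mul_thetaD, mul_zero, mul_zero]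

/-- The affine map `z ↦ a z + b` of the upper half-plane. -/
def aff (a b : ℝ) (ha : 0 < a) (z : ℍ) : ℍ :=
  ⟨a * z + b, by simpa using mul_pos ha z.im_pos⟩

lemma coe_aff (a b : ℝ) (ha : 0 < a) (z : ℍ) : (aff a b ha z : ℂ) = a * z + b := rfl

lemma im_aff (a b : ℝ) (ha : 0 < a) (z : ℍ) : (aff a b ha z).im = a * z.im := by
  simp [← coe_im, coe_aff]

lemma tendsto_aff (a b : ℝ) (ha : 0 < a) : Filter.Tendsto (aff a b ha) atImInfty atImInfty := by
  rw [atImInfty, Filter.tendsto_comap_iff]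
  simp only [Function.comp_def, im_aff]
  exact Filter.tendsto_comap.const_mul_atTop ha

lemma IsBoundedAtImInfty_comp_aff {f : ℍ → ℂ} (hf : IsBoundedAtImInfty f) (a b : ℝ) (ha : 0 < a) :
    IsBoundedAtImInfty fun z => f (aff a b ha z) :=
  hf.comp_tendsto (tendsto_aff a b ha)

lemma MDiff_comp_aff {f : ℍ → ℂ} (hf : MDifferentiable 𝓘(ℂ) 𝓘(ℂ) f) (a b : ℝ) (ha : 0 < a) :
    MDifferentiable 𝓘(ℂ) 𝓘(ℂ) fun z => f (aff a b ha z) := by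
  rw [UpperHalfPlane.mdifferentiable_iff] at hf ⊢
  have him : ∀ z : ℂ, ((a : ℂ) * z + b).im = a * z.im := fun z => by simp
  have h1 : DifferentiableOn ℂ (fun z : ℂ => (a : ℂ) * z + b) {z | 0 < z.im} := by fun_prop
  refine (hf.comp h1 fun z hz => ?_).congr fun z hz => ?_
  · simp only [Set.mem_ofPred_eq, him] at hz ⊢
    exact mul_pos ha hz
  · simp only [Function.comp]
    rw [ofComplex_apply_of_im_pos hz, ofComplex_apply_of_im_pos (by rw [him]; exact mul_pos ha hz)]
    rfl

lemma qq_add (z w : ℂ) : qq (z + w) = qq z * qq w := by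
  simp [qq, mul_add, Complex.exp_add]

lemma qq_natCast_mul (n : ℕ) (z : ℂ) : qq (n * z) = qq z ^ n := by
  rw [qq, qq, ← Complex.exp_nat_mul]; congr 1; ring

/-- The primitive cube root of unity `e^{2πi/3}`. -/
noncomputable def zeta3 : ℂ := qq (1 / 3)

lemma zeta3_primitive : IsPrimitiveRoot zeta3 3 := by
  have := Complex.isPrimitiveRoot_exp 3 (by norm_num)
  convert this using 1
  simp [zeta3, qq, div_eq_mul_inv]

lemma zeta3_pow_three : zeta3 ^ 3 = 1 := zeta3_primitive.pow_eq_one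

lemma zeta3_sum : 1 + zeta3 + zeta3 ^ 2 = 0 := by
  have := zeta3_primitive.geom_sum_eq_zero (by norm_num)
  simpa [Finset.sum_range_succ] using this

lemma zeta3_ne_zero : zeta3 ≠ 0 := qq_ne_zero _

lemma zeta3_zpow_three_mul (n : ℤ) : zeta3 ^ (3 * n) = 1 := by
  rw [_root_.zpow_mul, zpow_ofNat, zeta3_pow_three, _root_.one_zpow]

lemma one_add_zeta3_zpow (n : ℤ) (hn : ¬ 3 ∣ n) : 1 + zeta3 ^ n + (zeta3 ^ 2) ^ n = 0 := by
  have h := zeta3_sum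
  rw [← zpow_natCast, ← _root_.zpow_mul, mul_comm, _root_.zpow_mul]
  have h3 : n % 3 = 1 ∨ n % 3 = 2 := by omega
  have hz : zeta3 ^ n = zeta3 ^ (n % 3) := by
    conv_lhs => rw [← Int.mul_ediv_add_emod n 3, zpow_add₀ zeta3_ne_zero, zeta3_zpow_three_mul,
      one_mul]
  rw [hz]
  rcases h3 with h3 | h3 <;> rw [h3]
  · simpa using h
  · rw [zpow_ofNat, ← Nat.cast_ofNat, zpow_natCast]
    linear_combination h + zeta3 * zeta3_pow_three

/-- `F ↦ ∑ c^n F_n q^n`. -/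
noncomputable def twist (c : ℂ) (F : LaurentSeries ℂ) : LaurentSeries ℂ where
  coeff n := c ^ n * F.coeff n
  isPWO_support' := F.isPWO_support.mono fun n hn h0 => hn (by simp [h0])

lemma coeff_twist (c : ℂ) (F : LaurentSeries ℂ) (n : ℤ) :
    (twist c F).coeff n = c ^ n * F.coeff n := rfl

lemma QExp.comp_third {f : ℍ → ℂ} {F : LaurentSeries ℂ} (hf : QExp f F) :
    QExp (fun z => f (aff 1 (1 / 3) one_pos z)) (twist zeta3 F) := fun z => by
  convert hf (aff 1 (1 / 3) one_pos z) using 2 with n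
  rw [coeff_twist, coe_aff, Complex.ofReal_one, one_mul, qq_add, zeta3, _root_.mul_zpow]
  push_cast
  ring

/-- `F ↦ ∑ F_{3n} q^n`. -/
noncomputable def decimate (F : LaurentSeries ℂ) : LaurentSeries ℂ :=
  HahnSeries.ofSuppBddBelow (fun n => F.coeff (3 * n)) ⟨-|F.order|, fun n hn => by
    have := HahnSeries.order_le_of_coeff_ne_zero hn
    have := neg_abs_le F.order
    have := abs_nonneg F.order
    omega⟩

lemma coeff_decimate (F : LaurentSeries ℂ) (n : ℤ) : (decimate F).coeff n = F.coeff (3 * n) := by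
  rfl

/-- The operator `U₃`. -/
noncomputable def U3 (f : ℍ → ℂ) (z : ℍ) : ℂ :=
  (f (aff (1 / 3) 0 (by norm_num) z) + f (aff (1 / 3) (1 / 3) (by norm_num) z) +
    f (aff (1 / 3) (2 / 3) (by norm_num) z)) / 3

lemma QExp.U3 {f : ℍ → ℂ} {F : LaurentSeries ℂ} (hf : QExp f F) : QExp (U3 f) (decimate F) := by
  intro z
  set w := aff (1 / 3) 0 (by norm_num) z with hw
  have e1 : qq (aff (1 / 3) (1 / 3) (by norm_num) z) = qq w * zeta3 := by
    rw [hw, coe_aff, coe_aff, zeta3, ← qq_add]; congr 1; push_cast; ring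
  have e2 : qq (aff (1 / 3) (2 / 3) (by norm_num) z) = qq w * zeta3 ^ 2 := by
    rw [hw, coe_aff, coe_aff, zeta3, ← qq_natCast_mul, ← qq_add]; congr 1; push_cast; ring
  have e3 : qq z = qq w ^ 3 := by
    rw [← qq_natCast_mul, hw, coe_aff]; congr 1; push_cast; ring
  have h1 := hf (aff (1 / 3) (1 / 3) (by norm_num) z)
  have h2 := hf (aff (1 / 3) (2 / 3) (by norm_num) z)
  rw [e1] at h1
  rw [e2] at h2
  have h := (((hf w).add h1).add h2).div_const 3
  rw [← Function.Injective.hasSum_iff (g := fun n : ℤ => 3 * n)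
    (mul_right_injective₀ (by norm_num : (3 : ℤ) ≠ 0))] at h
  · refine h.congr_fun fun n => ?_
    have h6 : (zeta3 ^ 2) ^ (3 * n) = 1 := by
      rw [_root_.zpow_mul, zpow_ofNat, ← pow_mul, pow_mul', zeta3_pow_three, one_pow,
        _root_.one_zpow]
    simp only [Function.comp_apply]
    rw [coeff_decimate, e3, _root_.mul_zpow, _root_.mul_zpow, zeta3_zpow_three_mul, h6,
      _root_.zpow_mul, zpow_ofNat]
    ring
  · intro n hn
    have h3 : ¬ (3 : ℤ) ∣ n := fun ⟨k, hk⟩ => hn ⟨k, hk.symm⟩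
    rw [_root_.mul_zpow, _root_.mul_zpow]
    linear_combination F.coeff n * qq w ^ n / 3 * one_add_zeta3_zpow n h3

/-- Invariance under the Möbius action of `Γ₀(N)`. -/
def Gamma0Invariant (N : ℕ) (f : ℍ → ℂ) : Prop :=
  ∀ γ ∈ CongruenceSubgroup.Gamma0 N, ∀ z, f (γ • z) = f z

lemma slash_zero_apply (f : ℍ → ℂ) (γ : SL(2, ℤ)) (z : ℍ) : (f ∣[(0 : ℤ)] γ) z = f (γ • z) := by
  rw [SL_slash_apply, neg_zero, _root_.zpow_zero, mul_one]

lemma Gamma0Invariant.mul {N : ℕ} {f g : ℍ → ℂ} (hf : Gamma0Invariant N f)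
    (hg : Gamma0Invariant N g) : Gamma0Invariant N fun z => f z * g z := fun γ hγ z => by
  simp only [hf γ hγ, hg γ hγ]

/-- Liouville's theorem for `Γ₀(N)`. -/
lemma Gamma0Invariant.eq_const {N : ℕ} [NeZero N] {f : ℍ → ℂ}
    (hd : MDifferentiable 𝓘(ℂ) 𝓘(ℂ) f) (hf : Gamma0Invariant N f)
    (hb : ∀ γ : SL(2, ℤ), IsBoundedAtImInfty fun z => f (γ • z)) : ∃ c, ∀ z, f z = c := by
  let F : ModularForm ((CongruenceSubgroup.Gamma0 N).map (SpecialLinearGroup.mapGL ℝ)) 0 :=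
    { toFun := f
      slash_action_eq' := by
        rintro _ ⟨γ, hγ, rfl⟩
        ext z
        exact (slash_zero_apply f γ z).trans (hf γ hγ z)
      holo' := hd
      bdd_at_cusps' := by
        intro c hc
        rw [Subgroup.IsArithmetic.isCusp_iff_isCusp_SL2Z] at hc
        rw [OnePoint.isBoundedAt_iff_forall_SL2Z hc]
        intro γ _
        rw [show f ∣[(0 : ℤ)] γ = fun z => f (γ • z) from funext (slash_zero_apply f γ)]
        exact hb γ }
  obtain ⟨c, hc⟩ := ModularForm.eq_const_of_weight_zero F
  exact ⟨c, fun z => congrFun hc z⟩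

/-- A lower triangular representative of the cusp `1/3` of `Γ₀(9)`. -/
def lowerThree : SL(2, ℤ) := ⟨!![1, 0; 3, 1], by simp [Matrix.det_fin_two]⟩

/-- A lower triangular representative of the cusp `-1/3` of `Γ₀(9)`. -/
def lowerNegThree : SL(2, ℤ) := ⟨!![1, 0; -3, 1], by simp [Matrix.det_fin_two]⟩

lemma sl_mul_apply (A B : SL(2, ℤ)) (i j : Fin 2) :
    (A * B) i j = A i 0 * B 0 j + A i 1 * B 1 j :=
  (Matrix.mul_apply (M := A.1) (N := B.1)).trans (Fin.sum_univ_two _)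

lemma S_inv_apply (i j : Fin 2) : (ModularGroup.S⁻¹) i j = !![(0 : ℤ), 1; -1, 0] i j := by
  have h : (↑(ModularGroup.S⁻¹) : Matrix (Fin 2) (Fin 2) ℤ) = !![(0 : ℤ), 1; -1, 0] :=
    (Matrix.SpecialLinearGroup.coe_inv ModularGroup.S).trans (by
      rw [Matrix.adjugate_fin_two]; simp [ModularGroup.S])
  exact congrFun₂ h i j

lemma lowerThree_mul : lowerThree * lowerNegThree = 1 := by
  ext i j; rw [sl_mul_apply]; fin_cases i <;> fin_cases j <;> simp [lowerThree, lowerNegThree]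

lemma lowerNegThree_mul : lowerNegThree * lowerThree = 1 := by
  ext i j; rw [sl_mul_apply]; fin_cases i <;> fin_cases j <;> simp [lowerThree, lowerNegThree]

lemma mem_Gamma0_iff {N : ℕ} {γ : SL(2, ℤ)} : γ ∈ CongruenceSubgroup.Gamma0 N ↔ (N : ℤ) ∣ γ 1 0 := by
  rw [CongruenceSubgroup.Gamma0_mem, ZMod.intCast_zmod_eq_zero_iff_dvd]

lemma det_eq_one (γ : SL(2, ℤ)) : γ 0 0 * γ 1 1 - γ 0 1 * γ 1 0 = 1 := by
  have := γ.det_coe; rwa [Matrix.det_fin_two] at this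

/-- Coset representatives of `Γ₀(9)`, up to translations. -/
lemma exists_coset_rep (γ : SL(2, ℤ)) (h : ¬ (9 : ℤ) ∣ γ 1 0) :
    ∃ δ ∈ CongruenceSubgroup.Gamma0 9, (∃ k : ℤ, γ = δ * (ModularGroup.S * ModularGroup.T ^ k)) ∨
      γ = δ * lowerThree ∨ γ = δ * lowerNegThree := by
  have hdet := det_eq_one γ
  by_cases h3 : (3 : ℤ) ∣ γ 1 0
  · obtain ⟨c, hc⟩ := h3
    rw [hc] at h hdet
    have hd : ¬ (3 : ℤ) ∣ γ 1 1 := by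
      rintro ⟨d, hd⟩
      rw [hd] at hdet
      have h1 : (3 : ℤ) ∣ 1 := ⟨γ 0 0 * d - γ 0 1 * c, by linarith⟩
      norm_num at h1
    have hcd : (3 : ℤ) ∣ c - γ 1 1 ∨ (3 : ℤ) ∣ c + γ 1 1 := by
      have h1 : c % 3 = 1 ∨ c % 3 = 2 := by omega
      have h2 : γ 1 1 % 3 = 1 ∨ γ 1 1 % 3 = 2 := by omega
      omega
    rcases hcd with hcd | hcd
    · refine ⟨γ * lowerNegThree, ?_, Or.inr (Or.inl (by rw [mul_assoc, lowerNegThree_mul, mul_one]))⟩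
      rw [mem_Gamma0_iff, sl_mul_apply, hc,
        show lowerNegThree 0 0 = 1 from rfl, show lowerNegThree 1 0 = -3 from rfl]
      push_cast
      omega
    · refine ⟨γ * lowerThree, ?_, Or.inr (Or.inr (by rw [mul_assoc, lowerThree_mul, mul_one]))⟩
      rw [mem_Gamma0_iff, sl_mul_apply, hc,
        show lowerThree 0 0 = 1 from rfl, show lowerThree 1 0 = 3 from rfl]
      push_cast
      omega
  · set k := γ 1 1 * γ 1 0 ^ 5 with hk
    refine ⟨γ * (ModularGroup.S * ModularGroup.T ^ k)⁻¹, ?_, Or.inl ⟨k, by group⟩⟩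
    have h6 : (9 : ℤ) ∣ γ 1 0 ^ 6 - 1 := by
      generalize γ 1 0 = x at h3
      have hx : x % 9 = 1 ∨ x % 9 = 2 ∨ x % 9 = 4 ∨ x % 9 = 5 ∨ x % 9 = 7 ∨ x % 9 = 8 := by omega
      apply Int.dvd_of_emod_eq_zero
      rcases hx with hx | hx | hx | hx | hx | hx <;> simp [Int.sub_emod, pow_succ, Int.mul_emod, hx]
    have hX : (ModularGroup.S * ModularGroup.T ^ k)⁻¹ = ModularGroup.T ^ (-k) * ModularGroup.S⁻¹ := by
      group
    have hT : ∀ i j, (ModularGroup.T ^ (-k)) i j = !![1, -k; 0, 1] i j := fun i j =>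
      congrFun₂ (ModularGroup.coe_T_zpow (-k)) i j
    rw [hX, mem_Gamma0_iff, sl_mul_apply, sl_mul_apply, sl_mul_apply, hT, hT, hT, hT, S_inv_apply, S_inv_apply]
    simp
    obtain ⟨e, he⟩ := h6
    exact ⟨γ 1 1 * e, by rw [hk]; linear_combination γ 1 1 * he⟩

lemma bounded_of_cusps {f : ℍ → ℂ} (hf : Gamma0Invariant 9 f)
    (hS : IsBoundedAtImInfty fun z => f (ModularGroup.S • z))
    (h1 : IsBoundedAtImInfty fun z => f (lowerThree • z))
    (h2 : IsBoundedAtImInfty fun z => f (lowerNegThree • z)) (γ : SL(2, ℤ))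
    (h : ¬ (9 : ℤ) ∣ γ 1 0) : IsBoundedAtImInfty fun z => f (γ • z) := by
  obtain ⟨δ, hδ, ⟨k, rfl⟩ | rfl | rfl⟩ := exists_coset_rep γ h
  · have := IsBoundedAtImInfty_comp_aff hS 1 k one_pos
    refine this.congr_left fun z => ?_
    rw [mul_smul, hf δ hδ, mul_smul]
    congr 2
    rw [modular_T_zpow_smul]
    ext
    simp [coe_aff, add_comm]
  · simpa only [mul_smul, hf δ hδ] using! h1
  · simpa only [mul_smul, hf δ hδ] using! h2

lemma Gamma0Invariant.eq_const_of_cusps {f : ℍ → ℂ}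
    (hd : MDifferentiable 𝓘(ℂ) 𝓘(ℂ) f) (hf : Gamma0Invariant 9 f) (h0 : IsBoundedAtImInfty f)
    (hS : IsBoundedAtImInfty fun z => f (ModularGroup.S • z))
    (h1 : IsBoundedAtImInfty fun z => f (lowerThree • z))
    (h2 : IsBoundedAtImInfty fun z => f (lowerNegThree • z)) : ∃ c, ∀ z, f z = c := by
  refine hf.eq_const hd fun γ => ?_
  by_cases h : (9 : ℤ) ∣ γ 1 0
  · simpa only [hf γ (mem_Gamma0_iff.2 h)] using! h0
  · exact bounded_of_cusps hf hS h1 h2 γ h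

/-- Holomorphic `Γ₀(9)`-invariant functions that are bounded at all cusps except `∞`. -/
structure Sharp9 (f : ℍ → ℂ) : Prop where
  mdiff : MDifferentiable 𝓘(ℂ) 𝓘(ℂ) f
  inv : Gamma0Invariant 9 f
  bdd : ∀ γ : SL(2, ℤ), ¬ (9 : ℤ) ∣ γ 1 0 → IsBoundedAtImInfty fun z => f (γ • z)

lemma IsWeaklyHolomorphicSharp.sharp9 {f : ℍ → ℂ} (hf : IsWeaklyHolomorphicSharp 0 9 f) :
    Sharp9 f where
  mdiff := hf.1
  inv γ hγ z := by rw [← slash_zero_apply f, hf.2.1 γ hγ]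
  bdd γ hγ := by
    have := hf.2.2.2 γ hγ
    rwa [show f ∣[(0 : ℤ)] γ = fun z => f (γ • z) from funext (slash_zero_apply f γ)] at this

namespace Sharp9

variable {f g : ℍ → ℂ}

lemma eq_const (hf : Sharp9 f) (h0 : IsBoundedAtImInfty f) : ∃ c, ∀ z, f z = c := by
  refine hf.inv.eq_const hf.mdiff fun γ => ?_
  by_cases h : (9 : ℤ) ∣ γ 1 0
  · simpa only [hf.inv γ (mem_Gamma0_iff.2 h)] using! h0
  · exact hf.bdd γ h

lemma const (c : ℂ) : Sharp9 fun _ => c where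
  mdiff := mdifferentiable_const
  inv _ _ _ := rfl
  bdd _ _ := Filter.const_boundedAtFilter _ c

lemma add (hf : Sharp9 f) (hg : Sharp9 g) : Sharp9 fun z => f z + g z where
  mdiff := hf.mdiff.add hg.mdiff
  inv γ hγ z := by simp only [hf.inv γ hγ, hg.inv γ hγ]
  bdd γ hγ := (hf.bdd γ hγ).add (hg.bdd γ hγ)

lemma mul (hf : Sharp9 f) (hg : Sharp9 g) : Sharp9 fun z => f z * g z where
  mdiff := hf.mdiff.mul hg.mdiff
  inv := hf.inv.mul hg.inv
  bdd γ hγ := (hf.bdd γ hγ).mul (hg.bdd γ hγ)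

lemma pow (hf : Sharp9 f) (n : ℕ) : Sharp9 fun z => f z ^ n := by
  induction n with
  | zero => simpa using! const 1
  | succ n ih => simpa only [pow_succ] using ih.mul hf

lemma sub (hf : Sharp9 f) (hg : Sharp9 g) : Sharp9 fun z => f z - g z := by
  simpa [sub_eq_add_neg] using hf.add ((const (-1)).mul hg)

/-- A sharp form whose `q`-expansion has no terms of order `≤ 0` vanishes. -/
lemma eq_zero {F : LaurentSeries ℂ} (hf : Sharp9 f) (hF : QExp f F) (h0 : ∀ n ≤ 0, F.coeff n = 0)
    (z : ℍ) : f z = 0 := by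
  obtain ⟨c, hc⟩ := hf.eq_const (hF.bounded fun n hn => h0 n hn.le)
  have ht := hF.tendsto fun n hn => h0 n hn.le
  rw [h0 0 le_rfl, show f = fun _ => c from funext hc] at ht
  rw [hc, tendsto_nhds_unique tendsto_const_nhds ht]

/-- A sharp form is determined by the part of its `q`-expansion of order `≤ 0`. -/
lemma eq_of_coeff {F G : LaurentSeries ℂ} (hf : Sharp9 f) (hg : Sharp9 g) (hF : QExp f F)
    (hG : QExp g G) (h : ∀ n ≤ 0, F.coeff n = G.coeff n) (z : ℍ) : f z = g z :=
  sub_eq_zero.1 ((hf.sub hg).eq_zero (hF.sub hG) (fun n hn => by simp [h n hn]) z)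

end Sharp9

lemma coe_sl_smul (γ : SL(2, ℤ)) (z : ℍ) :
    ((γ • z : ℍ) : ℂ) = (γ 0 0 * z + γ 0 1) / (γ 1 0 * z + γ 1 1) := by
  rw [coe_specialLinearGroup_apply]
  simp

lemma sl_denom_ne_zero (γ : SL(2, ℤ)) (z : ℍ) : (γ 1 0 * z + γ 1 1 : ℂ) ≠ 0 := by
  have := UpperHalfPlane.denom_ne_zero γ z
  simpa [denom] using this

/-- Equality of `[a, b; 0, 1] γ` and `l γ' [a', b'; 0, 1]` gives equality of Möbius maps. -/
lemma aff_smul (γ γ' : SL(2, ℤ)) {a b a' b' : ℝ} (ha : 0 < a) (ha' : 0 < a') (l : ℝ)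
    (h00 : a * γ 0 0 + b * γ 1 0 = l * (γ' 0 0 * a'))
    (h01 : a * γ 0 1 + b * γ 1 1 = l * (γ' 0 0 * b' + γ' 0 1))
    (h10 : γ 1 0 = l * (γ' 1 0 * a'))
    (h11 : γ 1 1 = l * (γ' 1 0 * b' + γ' 1 1)) (z : ℍ) :
    aff a b ha (γ • z) = γ' • aff a' b' ha' z := by
  have h1 := sl_denom_ne_zero γ z
  have h2 := sl_denom_ne_zero γ' (aff a' b' ha' z)
  ext
  rw [coe_aff, coe_sl_smul, coe_sl_smul, ← mul_div_assoc, div_add' _ _ _ h1, div_eq_div_iff h1 h2,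
    coe_aff]
  have e00 : (a : ℂ) * γ 0 0 + b * γ 1 0 = l * (γ' 0 0 * a') := by exact_mod_cast h00
  have e01 : (a : ℂ) * γ 0 1 + b * γ 1 1 = l * (γ' 0 0 * b' + γ' 0 1) := by exact_mod_cast h01
  have e10 : (γ 1 0 : ℂ) = l * (γ' 1 0 * a') := by exact_mod_cast h10
  have e11 : (γ 1 1 : ℂ) = l * (γ' 1 0 * b' + γ' 1 1) := by exact_mod_cast h11
  linear_combination (z * (γ' 1 0 * (a' * z + b') + γ' 1 1) : ℂ) * e00 +
    (γ' 1 0 * (a' * z + b') + γ' 1 1 : ℂ) * e01 -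
    (γ' 0 0 * (a' * z + b') + γ' 0 1 : ℂ) * (z * e10 + e11)

lemma Sharp9.comp_third {f : ℍ → ℂ} (hf : Sharp9 f) :
    Sharp9 fun z => f (aff 1 (1 / 3) one_pos z) := by
  have hinv : Gamma0Invariant 9 fun z => f (aff 1 (1 / 3) one_pos z) := by
    intro γ hγ z
    obtain ⟨c, hc⟩ := mem_Gamma0_iff.1 hγ
    have hdet := det_eq_one γ
    push_cast at hc
    have had : (3 : ℤ) ∣ γ 1 1 - γ 0 0 := by
      rw [hc] at hdet
      have h1 : (3 : ℤ) ∣ γ 0 0 * γ 1 1 - 1 := ⟨3 * (γ 0 1 * c), by linarith⟩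
      generalize γ 0 0 = x at h1
      generalize γ 1 1 = y at h1
      have hx : x % 3 = 0 ∨ x % 3 = 1 ∨ x % 3 = 2 := by omega
      have hy : y % 3 = 0 ∨ y % 3 = 1 ∨ y % 3 = 2 := by omega
      have h2 := Int.emod_eq_zero_of_dvd h1
      apply Int.dvd_of_emod_eq_zero
      rcases hx with hx | hx | hx <;> rcases hy with hy | hy | hy <;>
        simp [Int.sub_emod, Int.mul_emod, hx, hy] at h2 ⊢
    obtain ⟨e, he⟩ := had
    let γ' : SL(2, ℤ) := ⟨!![γ 0 0 + 3 * c, γ 0 1 + e - c; γ 1 0, γ 1 1 - 3 * c], by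
      rw [Matrix.det_fin_two_of, hc]
      rw [hc] at hdet
      linear_combination hdet + (3 * c) * he⟩
    have e00 : γ' 0 0 = γ 0 0 + 3 * c := rfl
    have e01 : γ' 0 1 = γ 0 1 + e - c := rfl
    have e10 : γ' 1 0 = γ 1 0 := rfl
    have e11 : γ' 1 1 = γ 1 1 - 3 * c := rfl
    have hcR : (γ 1 0 : ℝ) = 9 * c := by exact_mod_cast hc
    have heR : (γ 1 1 : ℝ) - γ 0 0 = 3 * e := by exact_mod_cast he
    have hγ' : γ' ∈ CongruenceSubgroup.Gamma0 9 := mem_Gamma0_iff.2 (by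
      rw [e10]; exact mem_Gamma0_iff.1 hγ)
    refine Eq.trans (congrArg f ?_) (hf.inv γ' hγ' _)
    refine aff_smul γ γ' _ _ 1 ?_ ?_ ?_ ?_ z <;> simp only [e00, e01, e10, e11] <;> push_cast
    · linear_combination (1 / 3) * hcR
    · linear_combination (1 / 3) * heR
    · ring
    · linear_combination - (1 / 3) * hcR
  refine ⟨MDiff_comp_aff hf.mdiff _ _ _, hinv, bounded_of_cusps hinv ?_ ?_ ?_⟩
  · have := IsBoundedAtImInfty_comp_aff (hf.bdd lowerThree (by decide)) (1 / 9) (-1 / 3) (by norm_num)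
    refine this.congr_left fun z => ?_
    congr 1
    refine (aff_smul ModularGroup.S lowerThree _ _ 3 ?_ ?_ ?_ ?_ z).symm <;>
      simp [ModularGroup.S, lowerThree] <;> norm_num
  · let γ : SL(2, ℤ) := ⟨!![2, 1; 3, 2], by simp [Matrix.det_fin_two]⟩
    have := IsBoundedAtImInfty_comp_aff (hf.bdd γ (by decide)) 1 (-1 / 3) (by norm_num)
    refine this.congr_left fun z => ?_
    congr 1
    refine (aff_smul lowerThree γ _ _ 1 ?_ ?_ ?_ ?_ z).symm <;>
      simp [γ, lowerThree] <;> norm_num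
  · have := IsBoundedAtImInfty_comp_aff (hf.bdd ModularGroup.S (by decide)) 9 (-3) (by norm_num)
    refine this.congr_left fun z => ?_
    congr 1
    refine (aff_smul lowerNegThree ModularGroup.S _ _ (-1 / 3) ?_ ?_ ?_ ?_ z).symm <;>
      simp [ModularGroup.S, lowerNegThree] <;> norm_num

/-- The modular discriminant. -/
noncomputable abbrev disc (z : ℍ) : ℂ := ModularForm.discriminant z

lemma disc_smul (γ : SL(2, ℤ)) (z : ℍ) : disc (γ • z) = (γ 1 0 * z + γ 1 1) ^ 12 * disc z := by
  have h := SlashInvariantForm.slash_action_generators_SL2Z discriminant_S_invariant discriminant_T_invariant γ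
  have h1 := congrFun h z
  rw [SL_slash_apply] at h1
  have h2 := sl_denom_ne_zero γ z
  have h3 : denom γ z = γ 1 0 * z + γ 1 1 := by simp [denom]
  rw [h3, _root_.zpow_neg] at h1
  have h1' : disc (γ • z) * ((γ 1 0 * z + γ 1 1 : ℂ) ^ 12)⁻¹ = disc z := h1
  rw [← h1']
  field_simp

lemma disc_mdiff : MDifferentiable 𝓘(ℂ) 𝓘(ℂ) disc := CuspForm.discriminant.holo'

/-- `Δ / q`. -/
noncomputable def discUnit (z : ℍ) : ℂ := ∏' n : ℕ, (1 - qq z ^ (n + 1)) ^ 24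

lemma disc_eq (z : ℍ) : disc z = qq z * discUnit z := by
  rw [disc, discriminant_eq_q_prod, discUnit, qq_eq_qParam]

lemma discUnit_ne_zero (z : ℍ) : discUnit z ≠ 0 := fun h =>
  discriminant_ne_zero z (by rw [← disc, disc_eq, h, mul_zero])

lemma discUnit_tendsto : Filter.Tendsto discUnit atImInfty (nhds 1) := by
  have h := tendsto_atImInfty_tprod_one_sub_eta_q_pow
  refine h.congr fun z => ?_
  rw [discUnit, qq_eq_qParam]

lemma norm_tprod_one_sub_pow_sub_le {w : ℂ} (hw : ‖w‖ ≤ 1 / 2) :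
    ‖∏' n : ℕ, (1 - w ^ (n + 1)) - 1 + w‖ ≤ 8 * ‖w‖ ^ 2 := by
  have hw1 : ‖w‖ < 1 := by linarith
  have hm := multipliable_one_sub_pow hw1
  have hm' : Multipliable fun n : ℕ => 1 - w ^ (n + 1 + 1) := by
    have h : Summable fun n : ℕ => ‖-w ^ (n + 1 + 1)‖ := by
      simpa using (summable_nat_add_iff 2).2 (summable_geometric_of_lt_one (norm_nonneg w) hw1)
    simpa [sub_eq_add_neg] using multipliable_one_add_of_summable h
  have hsplit : ∏' n : ℕ, (1 - w ^ (n + 1)) = (1 - w) * ∏' n : ℕ, (1 - w ^ (n + 1 + 1)) := by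
    simpa using tprod_eq_zero_mul' (f := fun n : ℕ => 1 - w ^ (n + 1)) hm'
  have hk : ‖∏' n : ℕ, (1 - w ^ (n + 1 + 1)) - 1‖ ≤ 4 * ‖w‖ ^ 2 := by
    refine le_of_tendsto ((hm'.hasProd.tendsto_prod_nat.sub_const 1).norm)
      (Filter.Eventually.of_forall fun N => ?_)
    have h1 := (Finset.range N).norm_prod_one_add_sub_one_le fun n : ℕ => -w ^ (n + 1 + 1)
    simp only [← sub_eq_add_neg, norm_neg, norm_pow] at h1
    refine h1.trans ?_
    have hr : ∑ n ∈ Finset.range N, ‖w‖ ^ (n + 1 + 1) ≤ 2 * ‖w‖ ^ 2 := by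
      have h2 : ∑ n ∈ Finset.range N, ‖w‖ ^ n ≤ 2 := by
        refine ((summable_geometric_of_lt_one (norm_nonneg w) hw1).sum_le_tsum _
          fun _ _ => by positivity).trans ?_
        rw [tsum_geometric_of_lt_one (norm_nonneg w) hw1]
        rw [inv_le_comm₀ (by linarith) (by norm_num)]
        linarith
      calc _ = ‖w‖ ^ 2 * ∑ n ∈ Finset.range N, ‖w‖ ^ n := by
            rw [Finset.mul_sum]; exact Finset.sum_congr rfl fun n _ => by ring
        _ ≤ _ := by nlinarith [sq_nonneg ‖w‖]
    have hs1 : ∑ n ∈ Finset.range N, ‖w‖ ^ (n + 1 + 1) ≤ 1 := by nlinarith [norm_nonneg w]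
    have hs0 : 0 ≤ ∑ n ∈ Finset.range N, ‖w‖ ^ (n + 1 + 1) :=
      Finset.sum_nonneg fun _ _ => by positivity
    have h3 := Real.abs_exp_sub_one_le (abs_le.2 ⟨by linarith, hs1⟩)
    rw [abs_of_nonneg hs0] at h3
    linarith [le_abs_self (Real.exp (∑ n ∈ Finset.range N, ‖w‖ ^ (n + 1 + 1)) - 1)]
  rw [hsplit, show (1 - w) * ∏' n : ℕ, (1 - w ^ (n + 1 + 1)) - 1 + w =
    (1 - w) * (∏' n : ℕ, (1 - w ^ (n + 1 + 1)) - 1) by ring, norm_mul]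
  have h4 : ‖1 - w‖ ≤ 2 := (norm_sub_le _ _).trans (by rw [norm_one]; linarith)
  nlinarith [norm_nonneg (1 - w), norm_nonneg (∏' n : ℕ, (1 - w ^ (n + 1 + 1)) - 1)]

lemma hasDerivAt_tprod_one_sub_pow :
    HasDerivAt (fun w : ℂ => ∏' n : ℕ, (1 - w ^ (n + 1))) (-1) 0 := by
  rw [hasDerivAt_iff_isLittleO]
  have h : (fun w : ℂ => ∏' n : ℕ, (1 - w ^ (n + 1)) - 1 + w) =O[nhds 0] fun w => ‖w‖ ^ 2 := by
    refine Asymptotics.IsBigO.of_bound 8 ?_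
    filter_upwards [Metric.closedBall_mem_nhds (0 : ℂ) (by norm_num : (0 : ℝ) < 1 / 2)] with w hw
    simpa using norm_tprod_one_sub_pow_sub_le (by simpa using hw)
  have h2 : (fun w : ℂ => ‖w‖ ^ 2) =o[nhds 0] fun w => w :=
    (Asymptotics.isLittleO_norm_pow_id one_lt_two)
  refine (h.trans_isLittleO h2).congr (fun w => ?_) fun w => by simp
  simp

lemma discUnit_eq_pow (z : ℍ) : discUnit z = (∏' n : ℕ, (1 - qq z ^ (n + 1))) ^ 24 := by
  rw [discUnit, Multipliable.tprod_pow]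
  refine multipliable_one_sub_pow ?_
  rw [norm_qq, Real.exp_lt_one_iff]
  have := z.im_pos
  rw [coe_im]
  nlinarith [Real.pi_pos]

lemma qq_tendsto_punctured : Filter.Tendsto (fun z : ℍ => qq z) atImInfty (nhdsWithin 0 {0}ᶜ) :=
  tendsto_nhdsWithin_iff.2 ⟨qq_tendsto, Filter.Eventually.of_forall fun z => qq_ne_zero z⟩

lemma discUnit_slope_tendsto :
    Filter.Tendsto (fun z => (discUnit z - 1) / qq z) atImInfty (nhds (-24)) := by
  have h := hasDerivAt_tprod_one_sub_pow.pow 24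
  rw [hasDerivAt_iff_tendsto_slope] at h
  have h1 := h.comp qq_tendsto_punctured
  simp at h1
  refine h1.congr fun z => ?_
  simp [slope, discUnit_eq_pow, div_eq_inv_mul]

lemma coeff_ofPowerSeries_of_neg (P : PowerSeries ℂ) {n : ℤ} (hn : n < 0) :
    (HahnSeries.ofPowerSeries ℤ ℂ P).coeff n = 0 := by
  rw [HahnSeries.ofPowerSeries_apply]
  exact HahnSeries.embDomain_of_notMem_range (by simpa using hn)

/-- The Laurent series `q^{-m} + ∑_{n ≥ 1} a(n) q^n`. -/
noncomputable def canonicalSeries (m : ℕ) (a : ℕ → ℤ) : LaurentSeries ℂ :=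
  HahnSeries.single (-(m : ℤ)) 1 +
    HahnSeries.ofPowerSeries ℤ ℂ (PowerSeries.mk fun n => if n = 0 then 0 else (a n : ℂ))

lemma coeff_canonicalSeries_nat (m : ℕ) (a : ℕ → ℤ) {n : ℕ} (hn : n ≠ 0) :
    (canonicalSeries m a).coeff n = a n := by
  rw [canonicalSeries, HahnSeries.coeff_add, HahnSeries.coeff_single_of_ne (by omega),
    HahnSeries.ofPowerSeries_apply_coeff, PowerSeries.coeff_mk, if_neg hn, zero_add]

lemma coeff_canonicalSeries_of_nonpos (m : ℕ) (a : ℕ → ℤ) {n : ℤ} (hn : n ≤ 0) :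
    (canonicalSeries m a).coeff n = if n = -m then 1 else 0 := by
  rw [canonicalSeries, HahnSeries.coeff_add, HahnSeries.coeff_single]
  rcases hn.lt_or_eq with h | rfl
  · rw [coeff_ofPowerSeries_of_neg _ h, add_zero]
    split_ifs <;> rfl
  · have := HahnSeries.ofPowerSeries_apply_coeff (Γ := ℤ)
      (PowerSeries.mk fun n => if n = 0 then 0 else (a n : ℂ)) 0
    rw [Nat.cast_zero] at this
    simp [this]

lemma canonicalSeries_mem_intSeries (m : ℕ) (a : ℕ → ℤ) : canonicalSeries m a ∈ intSeries := by
  refine mem_intSeries.2 fun n => ?_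
  rcases le_or_gt n 0 with hn | hn
  · rw [coeff_canonicalSeries_of_nonpos m a hn]
    exact ⟨if n = -m then 1 else 0, by split_ifs <;> simp⟩
  · lift n to ℕ using hn.le
    exact ⟨a n, (coeff_canonicalSeries_nat m a (by omega)).symm⟩

lemma summable_of_im_le {a : ℕ → ℂ} {z w : ℍ} (h : z.im ≤ w.im)
    (hs : Summable fun n : ℕ => a n * qq z ^ (n + 1)) : Summable fun n : ℕ => a n * qq w ^ (n + 1) := by
  refine Summable.of_norm_bounded hs.norm fun n => ?_
  rw [norm_mul, norm_mul, norm_pow, norm_pow]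
  gcongr
  rw [norm_qq, norm_qq, Real.exp_le_exp, coe_im, coe_im]
  nlinarith [Real.pi_pos]

/-- The expansion of a canonical basis element converges everywhere. -/
lemma IsCanonicalBasis0.summable {m : ℕ} (hm : m ≠ 0) {f : ℍ → ℂ} {a : ℕ → ℤ}
    (h : IsCanonicalBasis0 9 m f a) (z : ℍ) :
    Summable fun n : ℕ => (a (n + 1) : ℂ) * qq z ^ (n + 1) := by
  by_contra hz
  have hf : ∀ w : ℍ, w.im ≤ z.im → f w = qq w ^ (-(m : ℤ)) := fun w hw => by
    rw [h.2 w, tsum_eq_zero_of_not_summable fun hs => hz (summable_of_im_le hw hs), add_zero]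
  let γ : SL(2, ℤ) := ⟨!![1, 0; 9, 1], by simp [Matrix.det_fin_two]⟩
  have hγ : γ ∈ CongruenceSubgroup.Gamma0 9 := mem_Gamma0_iff.2 (by simp [γ])
  let w : ℍ := ⟨z.im * Complex.I, by simpa using z.im_pos⟩
  have hw : w.im = z.im := by simp [w, ← coe_im]
  have hw0 : w.re = 0 := by simp [w, ← coe_re]
  have him : (γ • w).im = z.im / (81 * z.im ^ 2 + 1) := by
    have hden : denom γ w = γ 1 0 * w + γ 1 1 := by simp [denom]
    rw [ModularGroup.im_smul_eq_div_normSq, hw, hden, show γ 1 0 = 9 from rfl,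
      show γ 1 1 = 1 from rfl]
    congr 1
    simp [Complex.normSq_apply, hw, hw0]
    ring
  have hpos := z.im_pos
  have hlt : (γ • w).im < w.im := by
    rw [him, hw, div_lt_iff₀ (by positivity)]
    have : 0 < z.im * (81 * z.im ^ 2) := by positivity
    linarith
  have h1 := h.1.sharp9.inv γ hγ w
  rw [hf _ (hlt.le.trans hw.le), hf w hw.le] at h1
  have h2 := congrArg norm h1
  rw [norm_zpow, norm_zpow, norm_qq, norm_qq, _root_.zpow_neg, _root_.zpow_neg, _root_.inv_inj, zpow_natCast, zpow_natCast,
    pow_left_inj₀ (Real.exp_nonneg _) (Real.exp_nonneg _) hm, Real.exp_eq_exp, coe_im, coe_im] at h2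
  nlinarith [Real.pi_pos]

lemma IsCanonicalBasis0.qExp {m : ℕ} (hm : m ≠ 0) {f : ℍ → ℂ} {a : ℕ → ℤ}
    (h : IsCanonicalBasis0 9 m f a) : QExp f (canonicalSeries m a) := by
  have h2 : QExp (fun z => ∑' n : ℕ, (a (n + 1) : ℂ) * qq z ^ (n + 1))
      (HahnSeries.ofPowerSeries ℤ ℂ (PowerSeries.mk fun n => if n = 0 then 0 else (a n : ℂ))) := by
    refine QExp.ofPowerSeries fun z => ?_
    rw [← hasSum_nat_add_iff' 1]
    simpa using (h.summable hm z).hasSum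
  exact ((QExp.single (-(m : ℤ)) 1).add h2).congr (fun z => by rw [h.2 z, one_mul]) rfl

/-- The canonical basis elements are eigenfunctions of translation by `1/3`. -/
lemma IsCanonicalBasis0.apply_third {m : ℕ} (hm : m ≠ 0) {f : ℍ → ℂ} {a : ℕ → ℤ}
    (h : IsCanonicalBasis0 9 m f a) (z : ℍ) :
    f (aff 1 (1 / 3) one_pos z) = zeta3 ^ (-(m : ℤ)) * f z := by
  refine h.1.sharp9.comp_third.eq_of_coeff ((Sharp9.const _).mul h.1.sharp9) (h.qExp hm).comp_third
    ((QExp.const _).mul (h.qExp hm)) (fun n hn => ?_) z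
  rw [coeff_twist, HahnSeries.C_mul_eq_smul, HahnSeries.coeff_smul,
    coeff_canonicalSeries_of_nonpos m a hn]
  split_ifs with h <;> simp [h]

/-- `a(m, n)` vanishes unless `3 ∣ m + n`. -/
lemma IsCanonicalBasis0.coeff_eq_zero {m n : ℕ} (hm : m ≠ 0) (hn : n ≠ 0) {f : ℍ → ℂ} {a : ℕ → ℤ}
    (h : IsCanonicalBasis0 9 m f a) (h3 : ¬ 3 ∣ m + n) : a n = 0 := by
  have h1 := (h.qExp hm).comp_third.unique
    (((QExp.const _).mul (h.qExp hm)).congr (h.apply_third hm) rfl)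
  have h2 := congrArg (fun F : LaurentSeries ℂ => F.coeff n) h1
  simp only [coeff_twist, HahnSeries.C_mul_eq_smul, HahnSeries.coeff_smul,
    coeff_canonicalSeries_nat m a hn, smul_eq_mul] at h2
  by_contra ha
  have h4 := mul_right_cancel₀ (Int.cast_ne_zero.2 ha) h2
  rw [← div_eq_one_iff_eq (zpow_ne_zero _ zeta3_ne_zero), ← zpow_sub₀ zeta3_ne_zero,
    zeta3_primitive.zpow_eq_one_iff_dvd] at h4
  omega

lemma QExp.tendsto_mul_zpow {f : ℍ → ℂ} {F : LaurentSeries ℂ} (hf : QExp f F) (k : ℤ)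
    (h0 : ∀ n < k, F.coeff n = 0) :
    Filter.Tendsto (fun z : ℍ => qq z ^ (-k) * f z) atImInfty (nhds (F.coeff k)) := by
  have h := ((QExp.single (-k) 1).mul hf).tendsto fun n hn => by
    rw [HahnSeries.coeff_single_mul, h0 _ (by omega), mul_zero]
  simpa [HahnSeries.coeff_single_mul] using h

lemma isBoundedAtImInfty_of_tendsto {f : ℍ → ℂ} {c : ℂ}
    (h : Filter.Tendsto f atImInfty (nhds c)) : IsBoundedAtImInfty f :=
  h.isBigO_one ℝ

lemma Sharp9.mdiff_smul {f : ℍ → ℂ} (hf : Sharp9 f) (γ : SL(2, ℤ)) :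
    MDifferentiable 𝓘(ℂ) 𝓘(ℂ) fun z => f (γ • z) := by
  have h := hf.mdiff.slash 0 (Matrix.SpecialLinearGroup.mapGL ℝ γ)
  rwa [show f ∣[(0 : ℤ)] (Matrix.SpecialLinearGroup.mapGL ℝ γ) = fun z => f (γ • z) from
    funext fun z => slash_zero_apply f γ z] at h

/-- The local expansion of a sharp form at the cusp `0`. -/
lemma Sharp9.exists_value_at_zero {f : ℍ → ℂ} (hf : Sharp9 f) :
    ∃ c, IsBoundedAtImInfty fun z => (qq z)⁻¹ * (f (ModularGroup.S • aff 9 0 (by norm_num) z) - c) := by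
  let γ : SL(2, ℤ) := ⟨!![1, 0; -9, 1], by simp [Matrix.det_fin_two]⟩
  have hper : ∀ z : ℍ, f (ModularGroup.S • aff 9 0 (by norm_num) ((1 : ℝ) +ᵥ z)) =
      f (ModularGroup.S • aff 9 0 (by norm_num) z) := fun z => by
    rw [← hf.inv γ (mem_Gamma0_iff.2 (by simp [γ])) (ModularGroup.S • aff 9 0 (by norm_num) z)]
    congr 1
    have h1 := sl_denom_ne_zero γ (ModularGroup.S • aff 9 0 (by norm_num) z)
    have hz := (aff 9 0 (by norm_num) z).ne_zero
    have hz' := (aff 9 0 (by norm_num) ((1 : ℝ) +ᵥ z)).ne_zero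
    ext
    rw [coe_sl_smul γ, div_eq_inv_mul, ← mul_right_inj' h1, ← mul_assoc, mul_inv_cancel₀ h1, one_mul]
    rw [coe_sl_smul, coe_sl_smul]
    simp only [coe_aff] at *
    simp [γ, ModularGroup.S] at *
    field_simp
  have hexp := QExp.ofHolomorphic hper (MDiff_comp_aff (hf.mdiff_smul ModularGroup.S) 9 0 (by norm_num))
    (IsBoundedAtImInfty_comp_aff (hf.bdd ModularGroup.S (by decide)) 9 0 (by norm_num))
  set F := HahnSeries.ofPowerSeries ℤ ℂ
    (qExpansion 1 fun z => f (ModularGroup.S • aff 9 0 (by norm_num) z)) with hF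
  refine ⟨F.coeff 0, ?_⟩
  have h := (hexp.sub (QExp.const (F.coeff 0))).tendsto_mul_zpow 1 fun n hn => by
    rcases (show n ≤ 0 by omega).lt_or_eq with h | rfl
    · simp [hF, coeff_ofPowerSeries_of_neg _ h, HahnSeries.coeff_single_of_ne h.ne, HahnSeries.C_apply]
    · simp
  simpa using isBoundedAtImInfty_of_tendsto h

lemma aff_aff (a b a' b' : ℝ) (ha : 0 < a) (ha' : 0 < a') (z : ℍ) :
    aff a b ha (aff a' b' ha' z) = aff (a * a') (a * b' + b) (mul_pos ha ha') z := by
  ext; simp [coe_aff]; ring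

lemma aff_one_zero (z : ℍ) : aff 1 0 one_pos z = z := by ext; simp [coe_aff]

lemma aff_congr {a b a' b' : ℝ} (ha : 0 < a) (ha' : 0 < a') (h : a = a') (h' : b = b') (z : ℍ) :
    aff a b ha z = aff a' b' ha' z := by subst h h'; rfl

lemma disc_aff_smul (γ γ' : SL(2, ℤ)) {a b a' b' : ℝ} (ha : 0 < a) (ha' : 0 < a') {l : ℝ} (hl : l ≠ 0)
    (h00 : a * γ 0 0 + b * γ 1 0 = l * (γ' 0 0 * a'))
    (h01 : a * γ 0 1 + b * γ 1 1 = l * (γ' 0 0 * b' + γ' 0 1))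
    (h10 : γ 1 0 = l * (γ' 1 0 * a'))
    (h11 : γ 1 1 = l * (γ' 1 0 * b' + γ' 1 1)) (z : ℍ) :
    disc (aff a b ha (γ • z)) / disc (γ • z) = (l : ℂ)⁻¹ ^ 12 * (disc (aff a' b' ha' z) / disc z) := by
  have e10 : (γ 1 0 : ℂ) = l * (γ' 1 0 * a') := by exact_mod_cast h10
  have e11 : (γ 1 1 : ℂ) = l * (γ' 1 0 * b' + γ' 1 1) := by exact_mod_cast h11
  have hden : (γ 1 0 * z + γ 1 1 : ℂ) = l * (γ' 1 0 * aff a' b' ha' z + γ' 1 1) := by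
    rw [e10, e11, coe_aff]; ring
  have hl' : (l : ℂ) ≠ 0 := by exact_mod_cast hl
  have h1 := sl_denom_ne_zero γ' (aff a' b' ha' z)
  rw [aff_smul γ γ' ha ha' l h00 h01 h10 h11, disc_smul, disc_smul, hden]
  have := discriminant_ne_zero z
  field_simp

/-- `Δ(az) / Δ(z)` in terms of `q`. -/
lemma disc_div_eq (a b : ℝ) (ha : 0 < a) (z : ℍ) :
    disc (aff a b ha z) / disc z = qq (aff a b ha z) / qq z * (discUnit (aff a b ha z) / discUnit z) := by
  rw [disc_eq, disc_eq, mul_div_mul_comm]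

lemma discUnit_div_tendsto (a b : ℝ) (ha : 0 < a) :
    Filter.Tendsto (fun z => discUnit (aff a b ha z) / discUnit z) atImInfty (nhds 1) := by
  simpa using! (discUnit_tendsto.comp (tendsto_aff a b ha)).div discUnit_tendsto one_ne_zero

lemma MDiff_disc_div (a b : ℝ) (ha : 0 < a) :
    MDifferentiable 𝓘(ℂ) 𝓘(ℂ) fun z => disc (aff a b ha z) / disc z := by
  have h1 := MDiff_comp_aff disc_mdiff a b ha
  have h2 := disc_mdiff
  rw [UpperHalfPlane.mdifferentiable_iff] at *
  exact h1.div h2 fun z _ => discriminant_ne_zero _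

lemma disc_div_inv (N : ℕ) (hN : (0 : ℝ) < N) :
    Gamma0Invariant N fun z => disc (aff N 0 hN z) / disc z := by
  intro γ hγ z
  obtain ⟨c, hc⟩ := mem_Gamma0_iff.1 hγ
  have hdet := det_eq_one γ
  rw [hc] at hdet
  let γ' : SL(2, ℤ) := ⟨!![γ 0 0, N * γ 0 1; c, γ 1 1], by
    rw [Matrix.det_fin_two_of]; linear_combination hdet⟩
  have e00 : γ' 0 0 = γ 0 0 := rfl
  have e01 : γ' 0 1 = N * γ 0 1 := rfl
  have e10 : γ' 1 0 = c := rfl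
  have e11 : γ' 1 1 = γ 1 1 := rfl
  have h := disc_aff_smul γ γ' hN hN (b := 0) (b' := 0) one_ne_zero ?_ ?_ ?_ ?_ z
  · simpa using h
  all_goals simp [e00, e01, e10, e11, hc, mul_comm]

lemma Sharp9.ofGamma3 {f : ℍ → ℂ} (hf : Gamma0Invariant 3 f) : Gamma0Invariant 9 f := fun γ hγ z =>
  hf γ (mem_Gamma0_iff.2 ((by norm_num : ((3 : ℕ) : ℤ) ∣ ((9 : ℕ) : ℤ)).trans (mem_Gamma0_iff.1 hγ))) z

lemma Gamma0Invariant.comp {N : ℕ} {f : ℍ → ℂ} (hf : Gamma0Invariant N f) (F : ℂ → ℂ) :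
    Gamma0Invariant N fun z => F (f z) := fun γ hγ z => congrArg F (hf γ hγ z)

lemma isBounded_fun_mul {f g : ℍ → ℂ} (hf : IsBoundedAtImInfty f) (hg : IsBoundedAtImInfty g) :
    IsBoundedAtImInfty fun z => f z * g z := hf.mul hg

lemma isBounded_fun_const_mul {f : ℍ → ℂ} (c : ℂ) (hf : IsBoundedAtImInfty f) :
    IsBoundedAtImInfty fun z => c * f z := (Filter.const_boundedAtFilter atImInfty c).mul hf

lemma isBounded_fun_pow {f : ℍ → ℂ} (hf : IsBoundedAtImInfty f) (n : ℕ) :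
    IsBoundedAtImInfty fun z => f z ^ n := by
  induction n with
  | zero => simpa using! Filter.const_boundedAtFilter atImInfty (1 : ℂ)
  | succ n ih => simpa only [pow_succ] using isBounded_fun_mul ih hf

lemma Gamma0Invariant.eq_of_tendsto {f : ℍ → ℂ} {c : ℂ}
    (hd : MDifferentiable 𝓘(ℂ) 𝓘(ℂ) f) (hf : Gamma0Invariant 9 f)
    (h0 : Filter.Tendsto f atImInfty (nhds c))
    (hS : IsBoundedAtImInfty fun z => f (ModularGroup.S • z))
    (h1 : IsBoundedAtImInfty fun z => f (lowerThree • z))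
    (h2 : IsBoundedAtImInfty fun z => f (lowerNegThree • z)) (z : ℍ) : f z = c := by
  obtain ⟨d, hd⟩ := hf.eq_const_of_cusps hd (isBoundedAtImInfty_of_tendsto h0) hS h1 h2
  rw [show f = fun _ => d from funext hd] at h0 ⊢
  exact tendsto_nhds_unique tendsto_const_nhds h0

lemma isBounded_discUnit_div (a b : ℝ) (ha : 0 < a) :
    IsBoundedAtImInfty fun z => discUnit (aff a b ha z) / discUnit z :=
  isBoundedAtImInfty_of_tendsto (discUnit_div_tendsto a b ha)

lemma qq_aff_pow (n : ℕ) (a b : ℝ) (ha : 0 < a) (hn : (n : ℝ) * a = 1) (hb : b = 0) (z : ℍ) :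
    qq (aff a b ha z) ^ n = qq z := by
  have h : (n : ℂ) * a = 1 := by exact_mod_cast hn
  rw [← qq_natCast_mul, coe_aff, hb]
  congr 1
  push_cast
  linear_combination (z : ℂ) * h

lemma qq_aff_natCast (n : ℕ) (hn : (0 : ℝ) < n) (z : ℍ) : qq (aff n 0 hn z) = qq z ^ n := by
  rw [← qq_natCast_mul, coe_aff]; simp

/-- `t = q⁻¹ + O(q)` is a sharp form of level 9 with integral `q`-expansion `T`. -/
structure Hauptmodul9 (t : ℍ → ℂ) (T : LaurentSeries ℂ) : Prop where
  sharp : Sharp9 t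
  qExp : QExp t T
  coeff : ∀ n ≤ 0, T.coeff n = if n = -1 then 1 else 0
  third : ∀ z, t (aff 1 (1 / 3) one_pos z) = zeta3⁻¹ * t z
  integral : T ∈ intSeries

lemma IsCanonicalBasis0.hauptmodul {f : ℍ → ℂ} {a : ℕ → ℤ} (h : IsCanonicalBasis0 9 1 f a) :
    Hauptmodul9 f (canonicalSeries 1 a) where
  sharp := h.1.sharp9
  qExp := h.qExp one_ne_zero
  coeff n hn := by
    rw [coeff_canonicalSeries_of_nonpos 1 a hn]
    norm_num
  third z := by simpa using h.apply_third one_ne_zero z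
  integral := canonicalSeries_mem_intSeries 1 a

namespace Hauptmodul9

variable {t : ℍ → ℂ} {T : LaurentSeries ℂ} {c : ℂ}

lemma tendsto_q_mul (ht : Hauptmodul9 t T) :
    Filter.Tendsto (fun z : ℍ => qq z * t z) atImInfty (nhds 1) := by
  have := ht.qExp.tendsto_mul_zpow (-1) fun n hn => by
    rw [ht.coeff n (by omega), if_neg (by omega)]
  simpa [ht.coeff (-1) (by omega)] using this

lemma tendsto_q_mul_sub_div (ht : Hauptmodul9 t T) (c : ℂ) :
    Filter.Tendsto (fun z : ℍ => (qq z * (t z - c) - 1) / qq z) atImInfty (nhds (-c)) := by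
  have h := (((ht.qExp.sub (QExp.single (-1) 1)).sub (QExp.const c))).tendsto_mul_zpow 0 fun n hn => by
    simp [ht.coeff n hn.le, HahnSeries.coeff_single, HahnSeries.C_apply, hn.ne]
    split_ifs <;> simp
  have h1 : (T - HahnSeries.single (-1) 1 - HahnSeries.C c).coeff 0 = -c := by
    simp [ht.coeff 0 le_rfl]
  rw [h1] at h
  refine h.congr fun z => ?_
  have := qq_ne_zero z
  simp
  field_simp
  ring

/-- `(t - c)⁸ = Δ(z) / Δ(9z)`, where `c` is the value of `t` at the cusp `0`. -/
lemma sub_pow_eight (ht : Hauptmodul9 t T)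
    (hc : IsBoundedAtImInfty fun z => (qq z)⁻¹ * (t (ModularGroup.S • aff 9 0 (by norm_num) z) - c))
    (z : ℍ) : (t z - c) ^ 8 * (disc (aff 9 0 (by norm_num) z) / disc z) = 1 := by
  have hsub := ht.sharp.sub (Sharp9.const c)
  have hpow := hsub.pow 8
  have hinv : Gamma0Invariant 9 fun z => (t z - c) ^ 8 * (disc (aff 9 0 (by norm_num) z) / disc z) :=
    hpow.inv.mul (by simpa using disc_div_inv 9 (by norm_num))
  have hinf : Filter.Tendsto (fun z => (t z - c) ^ 8 * (disc (aff 9 0 (by norm_num) z) / disc z))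
      atImInfty (nhds 1) := by
    have h1 : Filter.Tendsto (fun z : ℍ => qq z * (t z - c)) atImInfty (nhds 1) := by
      simpa [mul_sub] using ht.tendsto_q_mul.sub (qq_tendsto.mul_const c)
    have h2 := (h1.pow 8).mul (discUnit_div_tendsto 9 0 (by norm_num))
    simp only [one_pow, mul_one] at h2
    refine h2.congr fun z => ?_
    have hq := qq_ne_zero z
    have h9 : qq (aff 9 0 (by norm_num) z) = qq z ^ 9 := by
      simpa using qq_aff_natCast 9 (by norm_num) z
    rw [disc_div_eq, h9]
    field_simp
  have hthird : ∀ (γ : SL(2, ℤ)) (b : ℝ), ¬ (9 : ℤ) ∣ γ 1 0 →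
      (∀ z, disc (aff 9 0 (by norm_num) (γ • z)) / disc (γ • z) =
        ((3 : ℝ) : ℂ)⁻¹ ^ 12 * (disc (aff 1 b one_pos z) / disc z)) →
      IsBoundedAtImInfty fun z => (t (γ • z) - c) ^ 8 *
        (disc (aff 9 0 (by norm_num) (γ • z)) / disc (γ • z)) := by
    intro γ b hγ h
    refine (isBounded_fun_mul (hpow.bdd γ hγ) (isBounded_fun_const_mul (((3 : ℝ) : ℂ)⁻¹ ^ 12 * qq b)
      (isBounded_discUnit_div 1 b one_pos))).congr_left fun z => ?_
    have hq := qq_ne_zero z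
    simp only [h, disc_div_eq, coe_aff, Complex.ofReal_one, one_mul, qq_add]
    field_simp
  have hS : IsBoundedAtImInfty fun z => (t (ModularGroup.S • z) - c) ^ 8 *
      (disc (aff 9 0 (by norm_num) (ModularGroup.S • z)) / disc (ModularGroup.S • z)) := by
    have h1 := IsBoundedAtImInfty_comp_aff hc (1 / 9) 0 (by norm_num)
    refine (isBounded_fun_mul (isBounded_fun_pow h1 8) (isBounded_fun_const_mul (((9 : ℝ) : ℂ)⁻¹ ^ 12)
      (isBounded_discUnit_div (1 / 9) 0 (by norm_num)))).congr_left fun z => ?_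
    rw [disc_aff_smul ModularGroup.S ModularGroup.S (l := 9) (a' := 1 / 9) (b' := 0) _ (by norm_num)
      (by norm_num), disc_div_eq]
    · rw [← qq_aff_pow 9 (1 / 9) 0 (by norm_num) (by norm_num) rfl z,
        show aff 9 0 (by norm_num) (aff (1 / 9) 0 (by norm_num) z) = z by ext; simp [coe_aff]]
      have hq := qq_ne_zero (aff (1 / 9) 0 (by norm_num) z)
      field_simp
    all_goals simp [ModularGroup.S]
  refine hinv.eq_of_tendsto (hpow.mdiff.mul (MDiff_disc_div 9 0 (by norm_num))) hinf hS
    (hthird lowerThree (1 / 3) (by decide) fun z => ?_)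
    (hthird lowerNegThree (-1 / 3) (by decide) fun z => ?_) z
  · refine disc_aff_smul lowerThree ⟨!![3, -1; 1, 0], by simp [Matrix.det_fin_two]⟩
      _ one_pos (by norm_num) ?_ ?_ ?_ ?_ z <;> simp [lowerThree] <;> norm_num
  · refine disc_aff_smul lowerNegThree ⟨!![3, 1; -1, 0], by simp [Matrix.det_fin_two]⟩
      _ one_pos (by norm_num) ?_ ?_ ?_ ?_ z <;> simp [lowerNegThree] <;> norm_num

end Hauptmodul9

/-- `z ↦ t(z/3)³`. -/
noncomputable def cubeThird (t : ℍ → ℂ) (z : ℍ) : ℂ := t (aff (1 / 3) 0 (by norm_num) z) ^ 3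

namespace Hauptmodul9

variable {t : ℍ → ℂ} {T : LaurentSeries ℂ} {c : ℂ}

lemma value_eq_three (ht : Hauptmodul9 t T)
    (hc : IsBoundedAtImInfty fun z => (qq z)⁻¹ * (t (ModularGroup.S • aff 9 0 (by norm_num) z) - c)) :
    c = 3 := by
  have hs : Filter.Tendsto (fun z : ℍ => qq z * (t z - c)) atImInfty (nhds 1) := by
    simpa [mul_sub] using ht.tendsto_q_mul.sub (qq_tendsto.mul_const c)
  have h9 := discUnit_slope_tendsto.comp (tendsto_aff 9 0 (by norm_num))
  have hU := discUnit_tendsto.comp (tendsto_aff 9 0 (by norm_num))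
  have h1 := ((ht.tendsto_q_mul_sub_div c).mul
    (tendsto_finsetSum (Finset.range 8) fun i _ => hs.pow i)).mul hU
  have h2 := h1.add (h9.mul (qq_tendsto.pow 8))
  have h3 := tendsto_nhds_unique discUnit_slope_tendsto (h2.congr fun z => ?_)
  · simp at h3
    linear_combination (-1 / 8) * h3
  · have hq := qq_ne_zero z
    have hU0 := discUnit_ne_zero z
    have hp := ht.sub_pow_eight hc z
    have hq9 : qq (aff 9 0 (by norm_num) z) = qq z ^ 9 := by
      simpa using qq_aff_natCast 9 (by norm_num) z
    rw [disc_div_eq, hq9] at hp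
    simp only [Function.comp_apply, hq9, div_mul_eq_mul_div, mul_geom_sum]
    have hp' : (qq z * (t z - c)) ^ 8 * discUnit (aff 9 0 (by norm_num) z) = discUnit z := by
      field_simp at hp
      linear_combination hp
    rw [← hp']
    field_simp
    ring

lemma cube_third (ht : Hauptmodul9 t T) (z : ℍ) (b : ℝ) (k : ℤ) (hb : b = k / 3) :
    t (aff 1 b one_pos z) ^ 3 = t z ^ 3 := by
  have h1 : ∀ w, t (aff 1 (1 / 3) one_pos w) ^ 3 = t w ^ 3 := fun w => by
    rw [ht.third, mul_pow, inv_pow, zeta3_pow_three, inv_one, one_mul]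
  subst hb
  have h2 : ∀ k : ℤ, t (aff 1 ((k + 1 : ℤ) / 3) one_pos z) ^ 3 = t (aff 1 (k / 3) one_pos z) ^ 3 := by
    intro k
    rw [← h1 (aff 1 (k / 3) one_pos z), aff_aff]
    congr 2
    exact aff_congr _ _ (by norm_num) (by push_cast; ring) z
  induction k using Int.induction_on with
  | zero => exact congrArg (t · ^ 3) ((aff_congr (b' := 0) one_pos one_pos rfl (by simp) z).trans
      (aff_one_zero z))
  | succ k ih => exact (h2 k).trans ih
  | pred k ih => rw [← ih, ← h2, sub_add_cancel]

lemma U3_cube (ht : Hauptmodul9 t T) (z : ℍ) : U3 (fun z => t z ^ 3) z = cubeThird t z := by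
  have h1 := ht.cube_third (aff (1 / 3) 0 (by norm_num) z) (1 / 3) 1 (by norm_num)
  have h2 := ht.cube_third (aff (1 / 3) 0 (by norm_num) z) (2 / 3) 2 (by norm_num)
  have e1 : aff 1 (1 / 3) one_pos (aff (1 / 3) 0 (by norm_num) z) =
      aff (1 / 3) (1 / 3) (by norm_num) z := by ext; simp [coe_aff]
  have e2 : aff 1 (2 / 3) one_pos (aff (1 / 3) 0 (by norm_num) z) =
      aff (1 / 3) (2 / 3) (by norm_num) z := by ext; simp [coe_aff]
  rw [e1] at h1
  rw [e2] at h2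
  simp only [U3, cubeThird, h1, h2]
  ring

lemma qExp_cubeThird (ht : Hauptmodul9 t T) : QExp (cubeThird t) (decimate (T ^ 3)) :=
  (ht.qExp.pow 3).U3.congr (fun z => (ht.U3_cube z).symm) rfl

lemma cubeThird_inv (ht : Hauptmodul9 t T) : Gamma0Invariant 3 (cubeThird t) := by
  intro γ hγ z
  obtain ⟨c, hc⟩ := mem_Gamma0_iff.1 hγ
  push_cast at hc
  have hdet := det_eq_one γ
  rw [hc] at hdet
  have hk : (3 : ℤ) ∣ γ 0 1 - γ 0 0 * (γ 0 0 * γ 0 1) := by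
    have h1 : (3 : ℤ) ∣ γ 0 0 * γ 1 1 - 1 := ⟨γ 0 1 * c, by linarith⟩
    have h2 : (3 : ℤ) ∣ 1 - γ 0 0 * γ 0 0 := by
      generalize γ 0 0 = x at h1
      generalize γ 1 1 = y at h1
      have hx : x % 3 = 0 ∨ x % 3 = 1 ∨ x % 3 = 2 := by omega
      have h2 := Int.emod_eq_zero_of_dvd h1
      apply Int.dvd_of_emod_eq_zero
      rcases hx with hx | hx | hx <;> simp [Int.sub_emod, Int.mul_emod, hx] at h2 ⊢
    obtain ⟨e, he⟩ := h2
    exact ⟨γ 0 1 * e, by linear_combination γ 0 1 * he⟩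
  obtain ⟨e, he⟩ := hk
  set k := γ 0 0 * γ 0 1 with hkdef
  let δ : SL(2, ℤ) := ⟨!![γ 0 0, e; 9 * c, γ 1 1 - 3 * c * k], by
    rw [Matrix.det_fin_two_of]; linear_combination hdet + 3 * c * he⟩
  have e00 : δ 0 0 = γ 0 0 := rfl
  have e01 : δ 0 1 = e := rfl
  have e10 : δ 1 0 = 9 * c := rfl
  have e11 : δ 1 1 = γ 1 1 - 3 * c * k := rfl
  have hδ : δ ∈ CongruenceSubgroup.Gamma0 9 := mem_Gamma0_iff.2 (by rw [e10]; exact ⟨c, rfl⟩)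
  have hcR : (γ 1 0 : ℝ) = 3 * c := by exact_mod_cast hc
  have heR : (γ 0 1 : ℝ) - γ 0 0 * k = 3 * e := by exact_mod_cast he
  have h := aff_smul γ δ (a := 1 / 3) (b := 0) (a' := 1 / 3) (b' := k / 3) (by norm_num) (by norm_num) 1
    ?_ ?_ ?_ ?_ z
  · rw [cubeThird, h, ht.sharp.inv δ hδ, cubeThird, ← ht.cube_third (aff (1 / 3) 0 _ z) (k / 3) k rfl, aff_aff]
    congr 2
    exact aff_congr _ _ (by norm_num) (by ring) z
  all_goals simp only [e00, e01, e10, e11]; push_cast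
  · ring
  · linear_combination (1 / 3) * heR
  · linear_combination hcR
  · ring

lemma cubeThird_mdiff (ht : Hauptmodul9 t T) : MDifferentiable 𝓘(ℂ) 𝓘(ℂ) (cubeThird t) :=
  MDiff_comp_aff (ht.sharp.pow 3).mdiff (1 / 3) 0 (by norm_num)

lemma tendsto_q_mul_cubeThird (ht : Hauptmodul9 t T) :
    Filter.Tendsto (fun z : ℍ => qq z * cubeThird t z) atImInfty (nhds 1) := by
  have h := (ht.tendsto_q_mul.comp (tendsto_aff (1 / 3) 0 (by norm_num))).pow 3
  rw [one_pow] at h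
  refine h.congr fun z => ?_
  rw [Function.comp_apply, mul_pow, qq_aff_pow 3 (1 / 3) 0 (by norm_num) (by norm_num) rfl z, cubeThird]

/-- `(t(z/3)³ - 27)² = Δ(z) / Δ(3z)`. -/
lemma cubeThird_sub_sq (ht : Hauptmodul9 t T)
    (hc : IsBoundedAtImInfty fun z => (qq z)⁻¹ * (t (ModularGroup.S • aff 9 0 (by norm_num) z) - c))
    (z : ℍ) : (cubeThird t z - c ^ 3) ^ 2 * (disc (aff 3 0 (by norm_num) z) / disc z) = 1 := by
  have hinv : Gamma0Invariant 3 fun z =>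
      (cubeThird t z - c ^ 3) ^ 2 * (disc (aff 3 0 (by norm_num) z) / disc z) :=
    (ht.cubeThird_inv.comp fun x => (x - c ^ 3) ^ 2).mul (by simpa using disc_div_inv 3 (by norm_num))
  have hinf : Filter.Tendsto (fun z =>
      (cubeThird t z - c ^ 3) ^ 2 * (disc (aff 3 0 (by norm_num) z) / disc z)) atImInfty (nhds 1) := by
    have h1 : Filter.Tendsto (fun z : ℍ => qq z * (cubeThird t z - c ^ 3)) atImInfty (nhds 1) := by
      simpa [mul_sub] using ht.tendsto_q_mul_cubeThird.sub (qq_tendsto.mul_const (c ^ 3))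
    have h2 := (h1.pow 2).mul (discUnit_div_tendsto 3 0 (by norm_num))
    simp only [one_pow, mul_one] at h2
    refine h2.congr fun z => ?_
    have hq := qq_ne_zero z
    have h3 : qq (aff 3 0 (by norm_num) z) = qq z ^ 3 := by
      simpa using qq_aff_natCast 3 (by norm_num) z
    rw [disc_div_eq, h3]
    field_simp
  have hS : IsBoundedAtImInfty fun z => (cubeThird t (ModularGroup.S • z) - c ^ 3) ^ 2 *
      (disc (aff 3 0 (by norm_num) (ModularGroup.S • z)) / disc (ModularGroup.S • z)) := by
    have h1 := IsBoundedAtImInfty_comp_aff hc (1 / 3) 0 (by norm_num)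
    have h2 := IsBoundedAtImInfty_comp_aff
      (((ht.sharp.pow 2).add ((ht.sharp.mul (Sharp9.const c)).add (Sharp9.const (c ^ 2)))).bdd
        ModularGroup.S (by decide)) 3 0 (by norm_num)
    refine (isBounded_fun_mul (isBounded_fun_pow (isBounded_fun_mul h1 h2) 2)
      (isBounded_fun_const_mul (((3 : ℝ) : ℂ)⁻¹ ^ 12)
      (isBounded_discUnit_div (1 / 3) 0 (by norm_num)))).congr_left fun z => ?_
    rw [disc_aff_smul ModularGroup.S ModularGroup.S (l := 3) (a' := 1 / 3) (b' := 0) _ (by norm_num)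
      (by norm_num), disc_div_eq]
    · rw [← qq_aff_pow 3 (1 / 3) 0 (by norm_num) (by norm_num) rfl z, cubeThird,
        aff_smul ModularGroup.S ModularGroup.S (a' := 3) (b' := 0) _ (by norm_num) (1 / 3),
        show aff 9 0 (by norm_num) (aff (1 / 3) 0 (by norm_num) z) = aff 3 0 (by norm_num) z by
          ext; simp [coe_aff]; ring]
      · have hq := qq_ne_zero (aff (1 / 3) 0 (by norm_num) z)
        field_simp
        ring
      all_goals simp [ModularGroup.S]
    all_goals simp [ModularGroup.S]
  refine (Sharp9.ofGamma3 hinv).eq_of_tendsto ?_ hinf hS ?_ ?_ z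
  · exact ((ht.cubeThird_mdiff.sub mdifferentiable_const).pow 2).mul (MDiff_disc_div 3 0 (by norm_num))
  · simpa only [hinv lowerThree (mem_Gamma0_iff.2 (by simp [lowerThree]))] using
      isBoundedAtImInfty_of_tendsto hinf
  · simpa only [hinv lowerNegThree (mem_Gamma0_iff.2 (by simp [lowerNegThree]))] using
      isBoundedAtImInfty_of_tendsto hinf

end Hauptmodul9

namespace Hauptmodul9

variable {t : ℍ → ℂ} {T : LaurentSeries ℂ}

lemma sub_three_pow_eight (ht : Hauptmodul9 t T) (z : ℍ) :
    (t z - 3) ^ 8 * (disc (aff 9 0 (by norm_num) z) / disc z) = 1 := by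
  obtain ⟨c, hc⟩ := ht.sharp.exists_value_at_zero
  have h := ht.sub_pow_eight hc z
  rwa [ht.value_eq_three hc] at h

lemma cubeThird_sub_twentySeven_sq (ht : Hauptmodul9 t T) (z : ℍ) :
    (cubeThird t z - 27) ^ 2 * (disc (aff 3 0 (by norm_num) z) / disc z) = 1 := by
  obtain ⟨c, hc⟩ := ht.sharp.exists_value_at_zero
  have h := ht.cubeThird_sub_sq hc z
  rw [ht.value_eq_three hc] at h
  norm_num at h ⊢
  exact h

lemma tendsto_q_mul_sub (ht : Hauptmodul9 t T) :
    Filter.Tendsto (fun z : ℍ => qq z * (t z - 3)) atImInfty (nhds 1) := by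
  simpa [mul_sub] using ht.tendsto_q_mul.sub (qq_tendsto.mul_const 3)

lemma tendsto_q_mul_cubeThird_sub (ht : Hauptmodul9 t T) :
    Filter.Tendsto (fun z : ℍ => qq z * (cubeThird t z - 27)) atImInfty (nhds 1) := by
  simpa [mul_sub] using ht.tendsto_q_mul_cubeThird.sub (qq_tendsto.mul_const 27)

lemma cubeThird_sub_mul_sub (ht : Hauptmodul9 t T) (z : ℍ) :
    (cubeThird t z - 27) * (t z ^ 3 - 27) = (t z - 3) ^ 4 := by
  have hsq : ∀ z, ((cubeThird t z - 27) * (t z ^ 3 - 27)) ^ 2 = ((t z - 3) ^ 4) ^ 2 := fun z => by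
    have h1 := ht.sub_three_pow_eight z
    have h2 := ht.cubeThird_sub_twentySeven_sq z
    have h3 := ht.cubeThird_sub_twentySeven_sq (aff 3 0 (by norm_num) z)
    rw [cubeThird, show aff (1 / 3) 0 (by norm_num) (aff 3 0 (by norm_num) z) = z by
        ext; simp [coe_aff],
      show aff 3 0 (by norm_num) (aff 3 0 (by norm_num) z) = aff 9 0 (by norm_num) z by
        ext; simp [coe_aff]; ring] at h3
    have d1 : disc z ≠ 0 := discriminant_ne_zero z
    have d3 : disc (aff 3 0 (by norm_num) z) ≠ 0 := discriminant_ne_zero _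
    have d9 : disc (aff 9 0 (by norm_num) z) ≠ 0 := discriminant_ne_zero _
    field_simp at h1 h2 h3
    apply mul_right_cancel₀ d9
    linear_combination -h1 + h2 + (cubeThird t z - 27) ^ 2 * h3
  have hA := (ht.qExp_cubeThird.sub (QExp.const 27)).mul ((ht.qExp.pow 3).sub (QExp.const 27))
  have hB := (ht.qExp.sub (QExp.const 3)).pow 4
  have key := ((hA.pow 2).congr (fun z => (hsq z).symm) rfl).unique (hB.pow 2)
  rcases sq_eq_sq_iff_eq_or_eq_neg.1 key with h | h
  · exact congrFun (QExp.funext hA (h ▸ hB)) z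
  · have hneg : ∀ z, (cubeThird t z - 27) * (t z ^ 3 - 27) = -(t z - 3) ^ 4 :=
      congrFun (QExp.funext hA ((QExp.const 0).sub hB |>.congr (fun z => by ring) (by rw [h]; simp)))
    have l1 := ht.tendsto_q_mul_sub.pow 4
    have l2 := ht.tendsto_q_mul_cubeThird_sub.mul ((ht.tendsto_q_mul.pow 3).sub
      ((qq_tendsto.pow 3).mul_const 27))
    have l3 := l1.add l2
    have l4 := tendsto_nhds_unique (l3.congr (f₂ := fun _ => 0) fun z => by
      linear_combination qq z ^ 4 * hneg z) tendsto_const_nhds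
    norm_num at l4

lemma cubeThird_sub_ne_zero (ht : Hauptmodul9 t T) (z : ℍ) : cubeThird t z - 27 ≠ 0 := fun h => by
  have := ht.cubeThird_sub_twentySeven_sq z
  simp [h] at this

end Hauptmodul9

/-- `z ↦ t(z/3)³ - 27`. -/
noncomputable def psi (t : ℍ → ℂ) : ℍ → ℂ := fun z => cubeThird t z - 27

namespace Hauptmodul9

variable {t : ℍ → ℂ} {T : LaurentSeries ℂ}

lemma psi_ne_zero (ht : Hauptmodul9 t T) (z : ℍ) : psi t z ≠ 0 := ht.cubeThird_sub_ne_zero z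

lemma third_values (ht : Hauptmodul9 t T) (z : ℍ) :
    t (aff (1 / 3) 0 (by norm_num) z) + t (aff (1 / 3) (1 / 3) (by norm_num) z) +
      t (aff (1 / 3) (2 / 3) (by norm_num) z) = 0 ∧
    t (aff (1 / 3) 0 (by norm_num) z) ^ 2 + t (aff (1 / 3) (1 / 3) (by norm_num) z) ^ 2 +
      t (aff (1 / 3) (2 / 3) (by norm_num) z) ^ 2 = 0 ∧
    t (aff (1 / 3) 0 (by norm_num) z) ^ 3 = psi t z + 27 ∧
    t (aff (1 / 3) (1 / 3) (by norm_num) z) ^ 3 = psi t z + 27 ∧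
    t (aff (1 / 3) (2 / 3) (by norm_num) z) ^ 3 = psi t z + 27 := by
  set w := aff (1 / 3) 0 (by norm_num) z with hw
  have e1 : aff (1 / 3) (1 / 3) (by norm_num) z = aff 1 (1 / 3) one_pos w := by
    ext; simp [hw, coe_aff]
  have e2 : aff (1 / 3) (2 / 3) (by norm_num) z =
      aff 1 (1 / 3) one_pos (aff 1 (1 / 3) one_pos w) := by
    ext; simp [hw, coe_aff]; ring
  have h0 : t w ^ 3 = psi t z + 27 := by simp [psi, cubeThird, hw]
  have hz := zeta3_ne_zero
  have hs := zeta3_sum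
  simp only [e1, e2, ht.third]
  refine ⟨?_, ?_, h0, ?_, ?_⟩
  · field_simp
    linear_combination t w * hs
  · field_simp
    linear_combination t w ^ 2 * (zeta3 ^ 2 - zeta3 + 1) * hs
  all_goals simp [mul_pow, zeta3_pow_three, h0]

lemma psi_mul_psi (ht : Hauptmodul9 t T) {v z : ℍ} (hv : t v ^ 3 = psi t z + 27) :
    psi t v * psi t z = (t v - 3) ^ 4 := by
  rw [← ht.cubeThird_sub_mul_sub v, hv, psi]
  ring

lemma psi_third (ht : Hauptmodul9 t T) (z : ℍ) : ∃ u₀ u₁ u₂ : ℂ,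
    u₀ + u₁ + u₂ = 0 ∧ u₀ ^ 2 + u₁ ^ 2 + u₂ ^ 2 = 0 ∧
    u₀ ^ 3 = psi t z + 27 ∧ u₁ ^ 3 = psi t z + 27 ∧ u₂ ^ 3 = psi t z + 27 ∧
    psi t (aff (1 / 3) 0 (by norm_num) z) * psi t z = (u₀ - 3) ^ 4 ∧
    psi t (aff (1 / 3) (1 / 3) (by norm_num) z) * psi t z = (u₁ - 3) ^ 4 ∧
    psi t (aff (1 / 3) (2 / 3) (by norm_num) z) * psi t z = (u₂ - 3) ^ 4 := by
  obtain ⟨hs1, hs2, h0, h1, h2⟩ := ht.third_values z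
  exact ⟨_, _, _, hs1, hs2, h0, h1, h2, ht.psi_mul_psi h0, ht.psi_mul_psi h1, ht.psi_mul_psi h2⟩

lemma U3_psi (ht : Hauptmodul9 t T) (z : ℍ) : U3 (psi t) z = -12 - 243 * (psi t z)⁻¹ := by
  obtain ⟨u₀, u₁, u₂, hs1, hs2, c0, c1, c2, h0, h1, h2⟩ := ht.psi_third z
  have hx := ht.psi_ne_zero z
  rw [U3]
  generalize psi t z = x at *
  field_simp
  linear_combination h0 + h1 + h2 + (u₀ - 12) * c0 + (u₁ - 12) * c1 + (u₂ - 12) * c2 +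
    (x + 27 - 108) * hs1 + 54 * hs2

lemma U3_psi_sq (ht : Hauptmodul9 t T) (z : ℍ) :
    U3 (fun z => psi t z ^ (2 : ℤ)) z = 252 - 177147 * (psi t z)⁻¹ ^ 2 := by
  obtain ⟨u₀, u₁, u₂, hs1, hs2, c0, c1, c2, h0, h1, h2⟩ := ht.psi_third z
  have hx := ht.psi_ne_zero z
  simp only [U3, zpow_ofNat]
  generalize psi t z = x at *
  have key : ∀ p u : ℂ, u ^ 3 = x + 27 → p * x = (u - 3) ^ 4 → (p * x) ^ 2 =
      252 * x ^ 2 - 177147 +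
      ((x + 27) ^ 2 * (-24) + (x + 27) * 70 * 81 - 8 * 2187) * u +
      ((x + 27) ^ 2 - 56 * 27 * (x + 27) + 28 * 729) * u ^ 2 := fun p u hu hp => by
    have h6 : u ^ 6 = (x + 27) ^ 2 := by rw [← hu]; ring
    rw [hp]
    linear_combination (u ^ 2 - 24 * u + 252) * h6 + (-1512 * u ^ 2 + 5670 * u - 13608) * hu
  have k0 := key _ _ c0 h0
  have k1 := key _ _ c1 h1
  have k2 := key _ _ c2 h2
  field_simp
  linear_combination k0 + k1 + k2 + ((x + 27) ^ 2 * (-24) + (x + 27) * 70 * 81 - 8 * 2187) * hs1 +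
    ((x + 27) ^ 2 - 56 * 27 * (x + 27) + 28 * 729) * hs2

lemma U3_psi_zpow (ht : Hauptmodul9 t T) (j : ℤ) (z : ℍ) :
    U3 (fun z => psi t z ^ (j + 3)) z =
      (-36 - 729 * (psi t z)⁻¹) * U3 (fun z => psi t z ^ (j + 2)) z -
      (270 + 26244 * (psi t z)⁻¹ + 531441 * (psi t z)⁻¹ ^ 2) * U3 (fun z => psi t z ^ (j + 1)) z +
      psi t z * U3 (fun z => psi t z ^ j) z := by
  obtain ⟨u₀, u₁, u₂, -, -, c0, c1, c2, h0, h1, h2⟩ := ht.psi_third z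
  have hx := ht.psi_ne_zero z
  have key : ∀ p u : ℂ, u ^ 3 = psi t z + 27 → p * psi t z = (u - 3) ^ 4 → p ≠ 0 → p ^ (j + 3) =
      (-36 - 729 * (psi t z)⁻¹) * p ^ (j + 2) -
      (270 + 26244 * (psi t z)⁻¹ + 531441 * (psi t z)⁻¹ ^ 2) * p ^ (j + 1) +
      psi t z * p ^ j := fun p u hu hp hp0 => by
    have hu' : psi t z = u ^ 3 - 27 := by rw [hu]; ring
    generalize psi t z = x at *
    have h3 : p ^ 3 = (-36 - 729 * x⁻¹) * p ^ 2 - (270 + 26244 * x⁻¹ + 531441 * x⁻¹ ^ 2) * p + x := by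
      have : (p * x) ^ 3 = (-36 * x - 729) * (p * x) ^ 2 -
          (270 * x ^ 2 + 26244 * x + 531441) * (p * x) + x ^ 4 := by
        rw [hp, hu']; ring
      field_simp
      apply mul_left_cancel₀ hx
      linear_combination this
    rw [zpow_add₀ hp0, zpow_add₀ hp0, zpow_add₀ hp0, zpow_one, zpow_ofNat, zpow_ofNat, h3]
    ring
  simp only [U3, key _ _ c0 h0 (ht.psi_ne_zero _), key _ _ c1 h1 (ht.psi_ne_zero _),
    key _ _ c2 h2 (ht.psi_ne_zero _)]
  ring

end Hauptmodul9

/-- `U₃` as an additive homomorphism. -/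
noncomputable def U3Hom : (ℍ → ℂ) →+ (ℍ → ℂ) :=
  AddMonoidHom.mk' U3 fun f g => by ext z; simp only [U3, Pi.add_apply]; ring

lemma U3Hom_apply (f : ℍ → ℂ) : U3Hom f = U3 f := rfl

lemma U3_one : U3 1 = 1 := by ext z; norm_num [U3]

/-- The additive group `f ℤ[f]`. -/
def tail (f : ℍ → ℂ) : AddSubgroup (ℍ → ℂ) := AddSubgroup.closure (Set.range fun k : ℕ => f ^ (k + 1))

/-- The additive group `ℤ[f]`. -/
def powers (f : ℍ → ℂ) : AddSubgroup (ℍ → ℂ) := AddSubgroup.closure (Set.range fun k : ℕ => f ^ k)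

/-- The additive group `n S`. -/
def dilate (n : ℤ) (S : AddSubgroup (ℍ → ℂ)) : AddSubgroup (ℍ → ℂ) := S.map (zsmulAddGroupHom n)

lemma mem_dilate {n : ℤ} {S : AddSubgroup (ℍ → ℂ)} {f : ℍ → ℂ} :
    f ∈ dilate n S ↔ ∃ g ∈ S, n • g = f := Iff.rfl

lemma smul_mem_dilate (n : ℤ) {S : AddSubgroup (ℍ → ℂ)} {f : ℍ → ℂ} (hf : f ∈ S) :
    n • f ∈ dilate n S := ⟨f, hf, rfl⟩

lemma dilate_mono (n : ℤ) {S R : AddSubgroup (ℍ → ℂ)} (h : S ≤ R) : dilate n S ≤ dilate n R :=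
  AddSubgroup.map_mono h

lemma dilate_le (n : ℤ) (S : AddSubgroup (ℍ → ℂ)) : dilate n S ≤ S := by
  rintro _ ⟨g, hg, rfl⟩
  exact S.zsmul_mem hg n

lemma dilate_dilate (m n : ℤ) (S : AddSubgroup (ℍ → ℂ)) : dilate m (dilate n S) = dilate (m * n) S := by
  ext f
  simp only [mem_dilate, exists_exists_and_eq_and, mul_smul]

lemma pow_mem_tail (f : ℍ → ℂ) (k : ℕ) : f ^ (k + 1) ∈ tail f :=
  AddSubgroup.subset_closure ⟨k, rfl⟩

lemma self_mem_tail (f : ℍ → ℂ) : f ∈ tail f := by simpa using pow_mem_tail f 0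

lemma pow_mem_powers (f : ℍ → ℂ) (k : ℕ) : f ^ k ∈ powers f :=
  AddSubgroup.subset_closure ⟨k, rfl⟩

lemma mul_mem_tail {f g : ℍ → ℂ} (hg : g ∈ tail f) : f * g ∈ tail f := by
  have h : tail f ≤ (tail f).comap (AddMonoidHom.mulLeft f) := by
    refine (AddSubgroup.closure_le _).2 ?_
    rintro _ ⟨k, rfl⟩
    show f * f ^ (k + 1) ∈ tail f
    rw [← pow_succ']
    exact pow_mem_tail f (k + 1)
  exact h hg

lemma tail_smul_le (n : ℤ) (f : ℍ → ℂ) : tail (n • f) ≤ dilate n (tail f) := by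
  refine (AddSubgroup.closure_le _).2 ?_
  rintro _ ⟨k, rfl⟩
  refine ⟨n ^ k • f ^ (k + 1), (tail f).zsmul_mem (pow_mem_tail f k) _, ?_⟩
  show n • n ^ k • f ^ (k + 1) = (n • f) ^ (k + 1)
  rw [← mul_smul, ← pow_succ', smul_pow]

lemma mul_mem_dilate {n : ℤ} {f g : ℍ → ℂ} (hg : g ∈ dilate n (tail f)) : f * g ∈ dilate n (tail f) := by
  obtain ⟨h, hh, rfl⟩ := hg
  exact ⟨f * h, mul_mem_tail hh, (mul_smul_comm n f h).symm⟩

lemma U3_dilate {n : ℤ} {S R : AddSubgroup (ℍ → ℂ)} (h : ∀ f ∈ S, U3 f ∈ R) {f : ℍ → ℂ}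
    (hf : f ∈ dilate n S) : U3 f ∈ dilate n R := by
  obtain ⟨g, hg, rfl⟩ := hf
  exact ⟨U3 g, h g hg, (map_zsmul U3Hom n g).symm⟩

/-- A sequence satisfying a three-term recurrence stays in a subgroup. -/
lemma three_term_induction {S : AddSubgroup (ℍ → ℂ)} {u : ℕ → ℍ → ℂ} (h0 : u 0 ∈ S) (h1 : u 1 ∈ S)
    (h2 : u 2 ∈ S) (h : ∀ j, u j ∈ S → u (j + 1) ∈ S → u (j + 2) ∈ S → u (j + 3) ∈ S) (j : ℕ) :
    u j ∈ S := by
  suffices u j ∈ S ∧ u (j + 1) ∈ S ∧ u (j + 2) ∈ S from this.1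
  induction j with
  | zero => exact ⟨h0, h1, h2⟩
  | succ j ih => exact ⟨ih.2.1, ih.2.2, h j ih.1 ih.2.1 ih.2.2⟩

/-- `9 / psi`. -/
noncomputable def ninePhi (t : ℍ → ℂ) : ℍ → ℂ := (9 : ℤ) • (psi t)⁻¹

lemma ninePhi_apply (t : ℍ → ℂ) (z : ℍ) : ninePhi t z = 9 * (psi t z)⁻¹ := by simp [ninePhi]

namespace Hauptmodul9

variable {t : ℍ → ℂ} {T : LaurentSeries ℂ}

lemma psi_mul_ninePhi (ht : Hauptmodul9 t T) : psi t * ninePhi t = 9 := by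
  ext z
  have := ht.psi_ne_zero z
  simp [ninePhi]
  field_simp

lemma U3_ninePhi_zpow (ht : Hauptmodul9 t T) (j : ℤ) :
    U3 (ninePhi t ^ (j + 3)) =
      (270 * ninePhi t + 2916 * ninePhi t ^ 2 + 6561 * ninePhi t ^ 3) * U3 (ninePhi t ^ (j + 2)) +
      (324 * ninePhi t + 729 * ninePhi t ^ 2) * U3 (ninePhi t ^ (j + 1)) +
      81 * ninePhi t * U3 (ninePhi t ^ j) := by
  have h : ∀ (i : ℤ) (z : ℍ), U3 (ninePhi t ^ i) z = 9 ^ i * U3 (fun z => psi t z ^ (-i)) z := fun i z => by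
    simp only [U3, Pi.pow_apply, ninePhi_apply, _root_.mul_zpow, _root_.inv_zpow']
    ring
  ext z
  have hx := ht.psi_ne_zero z
  have key := ht.U3_psi_zpow (-(j + 3)) z
  rw [show -(j + 3) + 3 = -j by ring, show -(j + 3) + 2 = -(j + 1) by ring,
    show -(j + 3) + 1 = -(j + 2) by ring] at key
  simp only [Pi.add_apply, Pi.mul_apply, Pi.pow_apply, h, Pi.ofNat_apply]
  simp only [ninePhi_apply]
  have h9 : (9 : ℂ) ≠ 0 := by norm_num
  rw [zpow_add₀ h9, zpow_add₀ h9, zpow_add₀ h9, zpow_one, zpow_ofNat, zpow_ofNat]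
  generalize psi t z = x at *
  generalize (9 : ℂ) ^ j = b
  field_simp at key ⊢
  linear_combination (-81 * b) * key

lemma U3_ninePhi_neg_one (ht : Hauptmodul9 t T) (z : ℍ) :
    9 * U3 (ninePhi t ^ (-1 : ℤ)) z = -12 - 27 * ninePhi t z := by
  have h := ht.U3_psi z
  have h1 : 9 * U3 (ninePhi t ^ (-1 : ℤ)) z = U3 (psi t) z := by
    simp [U3, ninePhi]
    ring
  rw [h1, h]
  simp [ninePhi]
  ring

lemma U3_ninePhi_neg_two (ht : Hauptmodul9 t T) (z : ℍ) :
    81 * U3 (ninePhi t ^ (-2 : ℤ)) z = 252 - 2187 * ninePhi t z ^ 2 := by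
  have h := ht.U3_psi_sq z
  have h1 : 81 * U3 (ninePhi t ^ (-2 : ℤ)) z = U3 (fun z => psi t z ^ (2 : ℤ)) z := by
    simp [U3, ninePhi, mul_pow, _root_.zpow_neg, zpow_ofNat]
    ring
  rw [h1, h]
  simp [ninePhi]
  ring

lemma U3_ninePhi (ht : Hauptmodul9 t T) :
    U3 (ninePhi t) = 90 * ninePhi t + 972 * ninePhi t ^ 2 + 2187 * ninePhi t ^ 3 := by
  ext z
  have h := congrFun (ht.U3_ninePhi_zpow (-2)) z
  have h1 := ht.U3_ninePhi_neg_one z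
  have h2 := ht.U3_ninePhi_neg_two z
  norm_num [U3_one, -Int.reduceNeg] at h
  norm_num at h h1 h2 ⊢
  linear_combination h + (36 * ninePhi t z + 81 * ninePhi t z ^ 2) * h1 + ninePhi t z * h2

lemma U3_ninePhi_sq (ht : Hauptmodul9 t T) :
    U3 (ninePhi t ^ 2) =
      (270 * ninePhi t + 2916 * ninePhi t ^ 2 + 6561 * ninePhi t ^ 3) * U3 (ninePhi t) +
      (216 * ninePhi t + 486 * ninePhi t ^ 2) := by
  ext z
  have h := congrFun (ht.U3_ninePhi_zpow (-1)) z
  have h1 := ht.U3_ninePhi_neg_one z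
  norm_num [U3_one, zpow_ofNat] at h h1 ⊢
  linear_combination h + 9 * ninePhi t z * h1

lemma U3_mem_dilate_nine (ht : Hauptmodul9 t T) {f : ℍ → ℂ} (hf : f ∈ tail (ninePhi t)) :
    U3 f ∈ dilate 9 (tail (ninePhi t)) := by
  have hrec := ht.U3_ninePhi_zpow
  have hone := ht.U3_ninePhi
  have htwo := ht.U3_ninePhi_sq
  set y := ninePhi t
  set N := dilate 9 (tail y)
  have hy : (9 : ℤ) • y ∈ N := smul_mem_dilate 9 (self_mem_tail y)
  have hmul : ∀ {g}, g ∈ N → y * g ∈ N := mul_mem_dilate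
  have hlin : ∀ {g} (a b c : ℤ), g ∈ N → (a * y + b * y ^ 2 + c * y ^ 3) * g ∈ N := fun {g} a b c hg => by
    rw [show (a * y + b * y ^ 2 + c * y ^ 3) * g = a • (y * g) + b • (y * (y * g)) +
      c • (y * (y * (y * g))) by simp only [zsmul_eq_mul]; ring]
    exact N.add_mem (N.add_mem (N.zsmul_mem (hmul hg) _) (N.zsmul_mem (hmul (hmul hg)) _))
      (N.zsmul_mem (hmul (hmul (hmul hg))) _)
  have h1 : U3 y ∈ N := by
    have := N.add_mem (N.zsmul_mem hy 10) (N.add_mem (N.zsmul_mem (hmul hy) 108)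
      (N.zsmul_mem (hmul (hmul hy)) 243))
    rw [hone]
    convert this using 1
    simp only [zsmul_eq_mul]
    push_cast
    ring
  have h2 : U3 (y ^ 2) ∈ N := by
    have := N.add_mem (hlin 270 2916 6561 h1) (N.add_mem (N.zsmul_mem hy 24)
      (N.zsmul_mem (hmul hy) 54))
    rw [htwo]
    convert this using 1
    simp only [zsmul_eq_mul]
    push_cast
    ring
  have hnat : ∀ j : ℕ, U3 (y ^ (j + 3)) = (270 * y + 2916 * y ^ 2 + 6561 * y ^ 3) * U3 (y ^ (j + 2)) +
      (324 * y + 729 * y ^ 2) * U3 (y ^ (j + 1)) + 81 * y * U3 (y ^ j) := fun j => by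
    exact_mod_cast hrec j
  have h3 : U3 (y ^ 3) ∈ N := by
    have := N.add_mem (N.add_mem (hlin 270 2916 6561 h2) (hlin 324 729 0 h1)) (N.zsmul_mem hy 9)
    rw [hnat 0, pow_zero, U3_one, zero_add, zero_add, pow_one]
    convert this using 1
    simp only [zsmul_eq_mul]
    push_cast
    ring
  have key : ∀ j : ℕ, U3 (y ^ (j + 1)) ∈ N := by
    refine three_term_induction (u := fun j => U3 (y ^ (j + 1))) (by simpa) h2 h3 fun j e0 e1 e2 => ?_
    have := N.add_mem (N.add_mem (hlin 270 2916 6561 e2) (hlin 324 729 0 e1)) (hlin 81 0 0 e0)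
    show U3 (y ^ (j + 1 + 3)) ∈ N
    rw [hnat (j + 1)]
    convert this using 1
    push_cast
    ring
  have hle : tail y ≤ N.comap U3Hom := by
    refine (AddSubgroup.closure_le _).2 ?_
    rintro _ ⟨k, rfl⟩
    exact key k
  exact hle hf

end Hauptmodul9

namespace Hauptmodul9

variable {t : ℍ → ℂ} {T : LaurentSeries ℂ}

lemma psi_mul_mem (ht : Hauptmodul9 t T) {f : ℍ → ℂ}
    (hf : f ∈ powers (psi t) ⊔ tail ((27 : ℤ) • ninePhi t)) :
    psi t * f ∈ powers (psi t) ⊔ tail ((27 : ℤ) • ninePhi t) := by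
  set R := powers (psi t) ⊔ tail ((27 : ℤ) • ninePhi t)
  suffices R ≤ R.comap (AddMonoidHom.mulLeft (psi t)) from this hf
  refine sup_le ((AddSubgroup.closure_le _).2 ?_) ((AddSubgroup.closure_le _).2 ?_)
  · rintro _ ⟨k, rfl⟩
    refine AddSubgroup.mem_sup_left (?_ : psi t * psi t ^ k ∈ _)
    rw [← pow_succ']
    exact pow_mem_powers _ _
  · rintro _ ⟨k, rfl⟩
    have h : psi t * ((27 : ℤ) • ninePhi t) ^ (k + 1) = (243 : ℤ) • ((27 : ℤ) • ninePhi t) ^ k := by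
      rw [pow_succ', ← mul_assoc, mul_smul_comm, ht.psi_mul_ninePhi]
      simp only [zsmul_eq_mul]
      norm_num
    show psi t * _ ∈ R
    rw [h]
    refine R.zsmul_mem ?_ _
    rcases k with _ | k
    · exact AddSubgroup.mem_sup_left (by simpa using pow_mem_powers (psi t) 0)
    · exact AddSubgroup.mem_sup_right (pow_mem_tail _ _)

lemma ninePhi_mul_mem (ht : Hauptmodul9 t T) {f : ℍ → ℂ}
    (hf : f ∈ powers (psi t) ⊔ tail ((27 : ℤ) • ninePhi t)) :
    ((27 : ℤ) • ninePhi t) * f ∈ powers (psi t) ⊔ tail ((27 : ℤ) • ninePhi t) := by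
  set w := (27 : ℤ) • ninePhi t with hw
  set R := powers (psi t) ⊔ tail w
  suffices R ≤ R.comap (AddMonoidHom.mulLeft w) from this hf
  refine sup_le ((AddSubgroup.closure_le _).2 ?_) ((AddSubgroup.closure_le _).2 ?_)
  · rintro _ ⟨k, rfl⟩
    show w * psi t ^ k ∈ R
    rcases k with _ | k
    · exact AddSubgroup.mem_sup_right (by simpa using self_mem_tail w)
    · have h : w * psi t ^ (k + 1) = (243 : ℤ) • psi t ^ k := by
        rw [pow_succ', ← mul_assoc, mul_comm w, hw, mul_smul_comm, ht.psi_mul_ninePhi]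
        simp only [zsmul_eq_mul]
        norm_num
      rw [h]
      exact R.zsmul_mem (AddSubgroup.mem_sup_left (pow_mem_powers _ _)) _
  · rintro _ ⟨k, rfl⟩
    exact AddSubgroup.mem_sup_right (mul_mem_tail (pow_mem_tail w k))

lemma U3_powers (ht : Hauptmodul9 t T) {f : ℍ → ℂ} (hf : f ∈ powers (psi t)) :
    U3 f ∈ powers (psi t) ⊔ tail ((27 : ℤ) • ninePhi t) := by
  have hpsi := fun {g} => ht.psi_mul_mem (f := g)
  have hnine := fun {g} => ht.ninePhi_mul_mem (f := g)
  set w := (27 : ℤ) • ninePhi t with hw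
  have hwz : ∀ z, w z = 243 * (psi t z)⁻¹ := fun z => by
    simp [hw, ninePhi_apply]
    ring
  set R := powers (psi t) ⊔ tail w
  have hone : 1 ∈ R := AddSubgroup.mem_sup_left (by simpa using pow_mem_powers (psi t) 0)
  have h1 : U3 (psi t) ∈ R := by
    have h : U3 (psi t) = (-12 : ℤ) • 1 - w * 1 := by
      ext z
      simp [ht.U3_psi, hwz]
    rw [h]
    exact R.sub_mem (R.zsmul_mem hone _) (hnine hone)
  have h2 : U3 (psi t ^ 2) ∈ R := by
    have h : U3 (psi t ^ 2) = (252 : ℤ) • 1 - (3 : ℤ) • (w * (w * 1)) := by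
      ext z
      have := ht.U3_psi_sq z
      simp only [zpow_ofNat] at this
      refine Eq.trans this ?_
      simp [hwz]
      ring
    rw [h]
    exact R.sub_mem (R.zsmul_mem hone _) (R.zsmul_mem (hnine (hnine hone)) _)
  have key : ∀ j : ℕ, U3 (psi t ^ j) ∈ R := by
    refine three_term_induction (u := fun j => U3 (psi t ^ j)) (by simpa [U3_one]) (by simpa) h2
      fun j e0 e1 e2 => ?_
    have h : U3 (psi t ^ (j + 3)) =
        (-36 : ℤ) • U3 (psi t ^ (j + 2)) - (3 : ℤ) • (w * U3 (psi t ^ (j + 2))) -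
        ((270 : ℤ) • U3 (psi t ^ (j + 1)) + (108 : ℤ) • (w * U3 (psi t ^ (j + 1))) +
          (9 : ℤ) • (w * (w * U3 (psi t ^ (j + 1))))) + psi t * U3 (psi t ^ j) := by
      ext z
      have h3 := ht.U3_psi_zpow j z
      norm_cast at h3
      simp only [show ∀ k : ℕ, (fun z => psi t z ^ k) = psi t ^ k from fun _ => rfl] at h3
      refine Eq.trans h3 ?_
      simp only [Pi.add_apply, Pi.sub_apply, Pi.smul_apply, Pi.mul_apply, hwz]
      simp only [zsmul_eq_mul]
      push_cast
      ring
    show U3 (psi t ^ (j + 3)) ∈ R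
    rw [h]
    exact R.add_mem (R.sub_mem (R.sub_mem (R.zsmul_mem e2 _) (R.zsmul_mem (hnine e2) _))
      (R.add_mem (R.add_mem (R.zsmul_mem e1 _) (R.zsmul_mem (hnine e1) _))
        (R.zsmul_mem (hnine (hnine e1)) _))) (hpsi e0)
  have hle : powers (psi t) ≤ R.comap U3Hom := by
    refine (AddSubgroup.closure_le _).2 ?_
    rintro _ ⟨k, rfl⟩
    exact key k
  exact hle hf

end Hauptmodul9

lemma coeff_mul_eq_zero {F G : LaurentSeries ℂ} {a b : ℤ} (hF : ∀ n < a, F.coeff n = 0)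
    (hG : ∀ n < b, G.coeff n = 0) : ∀ n < a + b, (F * G).coeff n = 0 := fun n hn => by
  rw [HahnSeries.coeff_mul]
  refine Finset.sum_eq_zero fun p hp => ?_
  rw [Finset.mem_antidiagonal] at hp
  by_cases h : p.1 < a
  · rw [hF _ h, zero_mul]
  · rw [hG _ (by omega), mul_zero]

lemma coeff_pow_eq_zero {F : LaurentSeries ℂ} {a : ℤ} (hF : ∀ n < a, F.coeff n = 0) (k : ℕ) :
    ∀ n < k * a, (F ^ k).coeff n = 0 := by
  induction k with
  | zero =>
    intro n hn
    rw [pow_zero, HahnSeries.coeff_one, if_neg (by simpa using hn.ne)]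
  | succ k ih =>
    rw [pow_succ, Nat.cast_succ, add_mul, one_mul]
    exact coeff_mul_eq_zero ih hF

lemma decimate_mem_intSeries {F : LaurentSeries ℂ} (hF : F ∈ intSeries) : decimate F ∈ intSeries :=
  fun n => hF (3 * n)

namespace Hauptmodul9

variable {t : ℍ → ℂ} {T : LaurentSeries ℂ}

lemma coeff_eq_zero (ht : Hauptmodul9 t T) : ∀ n < -1, T.coeff n = 0 := fun n hn => by
  rw [ht.coeff n (by omega), if_neg (by omega)]

lemma coeff_pow (ht : Hauptmodul9 t T) (k : ℕ) : (T ^ k).coeff (-k) = 1 := by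
  have h1 := (ht.qExp.pow k).tendsto_mul_zpow (-k) fun n hn =>
    coeff_pow_eq_zero ht.coeff_eq_zero k n (by linarith)
  have h2 := ht.tendsto_q_mul.pow k
  rw [one_pow] at h2
  refine tendsto_nhds_unique h1 (h2.congr fun z => ?_)
  rw [neg_neg, zpow_natCast, mul_pow]

/-- A sharp form of level 9 with integral `q`-expansion is an integral polynomial in `t`. -/
lemma exists_aeval (ht : Hauptmodul9 t T) (m : ℕ) {f : ℍ → ℂ} {F : LaurentSeries ℂ} (hf : Sharp9 f)
    (hF : QExp f F) (hint : F ∈ intSeries) (h0 : ∀ n < -(m : ℤ), F.coeff n = 0) :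
    ∃ p : Polynomial ℤ, ∀ z, f z = Polynomial.aeval (t z) p := by
  induction m generalizing f F with
  | zero =>
    obtain ⟨c, hc⟩ := mem_intSeries.1 hint 0
    refine ⟨Polynomial.C c, fun z => ?_⟩
    have := hf.eq_of_coeff (Sharp9.const (c : ℂ)) hF (QExp.const _) (fun n hn => ?_) z
    · simpa using this
    · rcases hn.lt_or_eq with h | rfl
      · rw [h0 n (by simpa), HahnSeries.C_apply, HahnSeries.coeff_single_of_ne h.ne]
      · simp [hc]
  | succ m ih =>
    obtain ⟨c, hc⟩ := mem_intSeries.1 hint (-(m + 1 : ℕ))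
    obtain ⟨p, hp⟩ := ih (hf.sub ((Sharp9.const (c : ℂ)).mul (ht.sharp.pow (m + 1))))
      (hF.sub ((QExp.const (c : ℂ)).mul (ht.qExp.pow (m + 1))))
      (sub_mem hint (mul_mem (single_mem_intSeries 0 c) (pow_mem ht.integral _))) fun n hn => by
        rw [HahnSeries.coeff_sub, HahnSeries.C_mul_eq_smul, HahnSeries.coeff_smul]
        rcases (show n ≤ -(m + 1 : ℕ) by push_cast; omega).lt_or_eq with h | rfl
        · rw [h0 n h, coeff_pow_eq_zero ht.coeff_eq_zero (m + 1) n (by linarith)]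
          simp
        · rw [ht.coeff_pow, hc]
          simp
    refine ⟨p + Polynomial.C c * Polynomial.X ^ (m + 1), fun z => ?_⟩
    have := hp z
    simp only [map_add, map_mul, map_pow, Polynomial.aeval_X, Polynomial.aeval_C, ← this]
    simp

lemma qExp_psi (ht : Hauptmodul9 t T) : QExp (psi t) (decimate (T ^ 3) - HahnSeries.C 27) :=
  ht.qExp_cubeThird.sub (QExp.const 27)

lemma coeff_psi_eq_zero (ht : Hauptmodul9 t T) (n : ℤ) (hn : n < -1) :
    (decimate (T ^ 3) - HahnSeries.C 27).coeff n = 0 := by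
  rw [HahnSeries.coeff_sub, coeff_decimate, HahnSeries.C_apply, HahnSeries.coeff_single_of_ne (by omega),
    coeff_pow_eq_zero ht.coeff_eq_zero 3 _ (by push_cast; omega), sub_zero]

lemma coeff_psi_neg_one (ht : Hauptmodul9 t T) :
    (decimate (T ^ 3) - HahnSeries.C 27).coeff (-1) = 1 := by
  have h := ht.qExp_psi.tendsto_mul_zpow (-1) ht.coeff_psi_eq_zero
  refine tendsto_nhds_unique h (ht.tendsto_q_mul_cubeThird_sub.congr fun z => ?_)
  rw [neg_neg, zpow_one, psi]

lemma psi_mem_intSeries (ht : Hauptmodul9 t T) : decimate (T ^ 3) - HahnSeries.C 27 ∈ intSeries :=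
  sub_mem (decimate_mem_intSeries (pow_mem ht.integral 3)) (by simpa using! single_mem_intSeries 0 27)

lemma tendsto_inv_psi (ht : Hauptmodul9 t T) :
    Filter.Tendsto (psi t)⁻¹ atImInfty (nhds 0) := by
  have h := qq_tendsto.mul (ht.tendsto_q_mul_cubeThird_sub.inv₀ one_ne_zero)
  rw [zero_mul] at h
  refine h.congr fun z => ?_
  have := qq_ne_zero z
  simp only [psi, Pi.inv_apply]
  field_simp

lemma exists_qExp_inv_psi (ht : Hauptmodul9 t T) :
    ∃ H ∈ intSeries, QExp (psi t)⁻¹ H ∧ ∀ n < 1, H.coeff n = 0 := by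
  have hper : ∀ z, (psi t)⁻¹ ((1 : ℝ) +ᵥ z) = (psi t)⁻¹ z := fun z => by
    have h := ht.cubeThird_inv ModularGroup.T (mem_Gamma0_iff.2 ⟨0, by simp [ModularGroup.T]⟩) z
    rw [modular_T_smul] at h
    simp only [Pi.inv_apply, psi, h]
  have hd : MDifferentiable 𝓘(ℂ) 𝓘(ℂ) (psi t)⁻¹ := by
    have h1 := ht.cubeThird_mdiff.sub (mdifferentiable_const (c := (27 : ℂ)))
    rw [UpperHalfPlane.mdifferentiable_iff] at *
    exact h1.inv fun z _ => ht.cubeThird_sub_ne_zero _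
  have hlim := ht.tendsto_inv_psi
  have hq := QExp.ofHolomorphic hper hd (hlim.isBigO_one ℝ)
  set H := HahnSeries.ofPowerSeries ℤ ℂ (qExpansion 1 (psi t)⁻¹)
  have hneg : ∀ n < 0, H.coeff n = 0 := fun n hn => coeff_ofPowerSeries_of_neg _ hn
  have h0 := tendsto_nhds_unique (hq.tendsto hneg) hlim
  set Ψ := decimate (T ^ 3) - HahnSeries.C 27
  have hΨ : Ψ * H = 1 := (ht.qExp_psi.mul hq).unique
    ((QExp.const 1).congr (fun z => mul_inv_cancel₀ (ht.psi_ne_zero z)) (by simp))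
  refine ⟨H, ?_, hq, fun n hn => ?_⟩
  · have hs : HahnSeries.single 1 1 ∈ intSeries := by simpa using! single_mem_intSeries 1 1
    refine mem_intSeries_of_eq_add_mul hs
      (sub_mem (one_mem _) (mul_mem hs ht.psi_mem_intSeries)) (fun n hn => ?_)
      (B := 1 - HahnSeries.single 1 1 * Ψ) (by linear_combination (HahnSeries.single 1 1) * hΨ)
    rw [HahnSeries.coeff_sub, HahnSeries.coeff_single_mul, HahnSeries.coeff_one]
    rcases (show n ≤ 0 by omega).lt_or_eq with h | rfl
    · rw [ht.coeff_psi_eq_zero _ (by omega), if_neg h.ne]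
      simp
    · rw [zero_sub, ht.coeff_psi_neg_one]
      simp
  · rcases (show n ≤ 0 by omega).lt_or_eq with h | rfl
    · exact hneg n h
    · exact h0

lemma exists_qExp_of_mem_tail (ht : Hauptmodul9 t T) {f : ℍ → ℂ} (hf : f ∈ tail (psi t)⁻¹) :
    ∃ H ∈ intSeries, QExp f H ∧ ∀ n < 1, H.coeff n = 0 := by
  obtain ⟨H, hH, hq, h0⟩ := ht.exists_qExp_inv_psi
  induction hf using AddSubgroup.closure_induction with
  | mem f hf =>
    obtain ⟨k, rfl⟩ := hf
    refine ⟨H ^ (k + 1), pow_mem hH _, hq.pow _, fun n hn => ?_⟩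
    exact coeff_pow_eq_zero h0 (k + 1) n (by push_cast; omega)
  | zero => exact ⟨0, zero_mem _, (QExp.const 0).congr (fun _ => rfl) (by simp), by simp⟩
  | add f g _ _ hf hg =>
    obtain ⟨F, hF, hFq, hF0⟩ := hf
    obtain ⟨G, hG, hGq, hG0⟩ := hg
    exact ⟨F + G, add_mem hF hG, hFq.add hGq, fun n hn => by simp [hF0 n hn, hG0 n hn]⟩
  | neg f _ hf =>
    obtain ⟨F, hF, hFq, hF0⟩ := hf
    exact ⟨-F, neg_mem hF, ((QExp.const 0).sub hFq).congr (fun z => by simp) (by simp),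
      fun n hn => by simp [hF0 n hn]⟩

/-- Elements of `n y ℤ[y]`, where `y = 9 / psi`, have `q`-expansions `O(q)` divisible by `9 n`. -/
lemma exists_coeff_of_mem_dilate (ht : Hauptmodul9 t T) {n : ℤ} {f : ℍ → ℂ}
    (hf : f ∈ dilate n (tail (ninePhi t))) {F : LaurentSeries ℂ} (hF : QExp f F) :
    (∀ k ≤ 0, F.coeff k = 0) ∧ ∀ k, ∃ c : ℤ, F.coeff k = (n * 9 * c : ℤ) := by
  have h1 : f ∈ dilate (n * 9) (tail (psi t)⁻¹) := by
    rw [← dilate_dilate]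
    exact dilate_mono n (tail_smul_le 9 _) hf
  obtain ⟨g, hg, rfl⟩ := h1
  obtain ⟨H, hH, hq, h0⟩ := ht.exists_qExp_of_mem_tail hg
  have key : F = ((n * 9 : ℤ) : LaurentSeries ℂ) * H :=
    hF.unique (((QExp.const ((n * 9 : ℤ) : ℂ)).mul hq).congr (fun z => by simp)
      (by rw [map_intCast]))
  subst key
  refine ⟨fun k hk => by rw [coeff_intCast_mul, h0 k (by omega), mul_zero], fun k => ?_⟩
  obtain ⟨c, hc⟩ := mem_intSeries.1 hH k
  exact ⟨c, by rw [coeff_intCast_mul, ← hc]; push_cast; ring⟩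

end Hauptmodul9

lemma exists_aeval_of_mem_powers {f g : ℍ → ℂ} (hf : f ∈ powers g) :
    ∃ p : Polynomial ℤ, ∀ z, f z = Polynomial.aeval (g z) p := by
  induction hf using AddSubgroup.closure_induction with
  | mem f hf =>
    obtain ⟨k, rfl⟩ := hf
    exact ⟨Polynomial.X ^ k, fun z => by simp⟩
  | zero => exact ⟨0, fun z => by simp⟩
  | add f h _ _ hf hh =>
    obtain ⟨p, hp⟩ := hf
    obtain ⟨r, hr⟩ := hh
    exact ⟨p + r, fun z => by simp [hp, hr]⟩
  | neg f _ hf =>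
    obtain ⟨p, hp⟩ := hf
    exact ⟨-p, fun z => by simp [hp]⟩

lemma QExp.U3_iterate {f : ℍ → ℂ} {F : LaurentSeries ℂ} (hf : QExp f F) (k : ℕ) :
    QExp (_root_.U3^[k] f) (decimate^[k] F) := by
  induction k generalizing f F with
  | zero => exact hf
  | succ k ih => exact ih hf.U3

lemma coeff_decimate_iterate (F : LaurentSeries ℂ) (k : ℕ) (n : ℤ) :
    (decimate^[k] F).coeff n = F.coeff (3 ^ k * n) := by
  induction k generalizing F with
  | zero => simp
  | succ k ih => rw [Function.iterate_succ_apply, ih, coeff_decimate, pow_succ', mul_assoc]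

namespace Hauptmodul9

variable {t : ℍ → ℂ} {T : LaurentSeries ℂ}

/-- A polynomial in `psi` without principal part and constant term vanishes. -/
lemma eq_zero_of_mem_powers (ht : Hauptmodul9 t T) {f : ℍ → ℂ} (hf : f ∈ powers (psi t))
    {F : LaurentSeries ℂ} (hF : QExp f F) (h0 : ∀ n ≤ 0, F.coeff n = 0) : f = 0 := by
  obtain ⟨p, hp⟩ := exists_aeval_of_mem_powers hf
  have hlim : Filter.Tendsto f atImInfty (nhds 0) := by
    simpa [h0 0 le_rfl] using hF.tendsto fun n hn => h0 n hn.le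
  have hpsi : Filter.Tendsto (fun z => ‖psi t z‖) atImInfty Filter.atTop := by
    have h1 : Filter.Tendsto (psi t)⁻¹ atImInfty (nhdsWithin 0 {0}ᶜ) :=
      tendsto_nhdsWithin_iff.2 ⟨ht.tendsto_inv_psi,
        Filter.Eventually.of_forall fun z => inv_ne_zero (ht.psi_ne_zero z)⟩
    exact (tendsto_norm_inv_nhdsNE_zero_atTop.comp h1).congr fun z => by simp
  have hp' : ∀ z, f z = (p.map (Int.castRingHom ℂ)).eval (psi t z) := fun z => by
    rw [hp, Polynomial.aeval_def, Polynomial.eval_map]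
    rfl
  by_cases hd : 0 < (p.map (Int.castRingHom ℂ)).degree
  · have h := Polynomial.tendsto_norm_atTop _ hd hpsi
    simp only [← hp'] at h
    exact (not_tendsto_nhds_of_tendsto_atTop h _ hlim.norm).elim
  · rw [Polynomial.eq_C_of_degree_le_zero (not_lt.1 hd)] at hp'
    simp only [Polynomial.eval_C] at hp'
    ext z
    rw [hp']
    exact tendsto_nhds_unique (tendsto_const_nhds.congr fun z => (hp' z).symm) hlim

lemma mem_dilate_of_coeff (ht : Hauptmodul9 t T) {f : ℍ → ℂ}
    (hf : f ∈ powers (psi t) ⊔ tail ((27 : ℤ) • ninePhi t)) {F : LaurentSeries ℂ} (hF : QExp f F)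
    (h0 : ∀ n ≤ 0, F.coeff n = 0) : f ∈ dilate 27 (tail (ninePhi t)) := by
  obtain ⟨g, hg, h, hh, rfl⟩ := AddSubgroup.mem_sup.1 hf
  have hh' := tail_smul_le 27 _ hh
  obtain ⟨H, -, hH, hH0⟩ := ht.exists_qExp_of_mem_tail
    (dilate_le 9 _ (tail_smul_le 9 _ (dilate_le 27 _ hh')))
  have hg0 : g = 0 := by
    refine ht.eq_zero_of_mem_powers hg ((hF.sub hH).congr (fun z => by simp) rfl) fun n hn => ?_
    rw [HahnSeries.coeff_sub, h0 n hn, hH0 n (by omega), sub_zero]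
  rwa [hg0, zero_add]

lemma U3_aeval_mem_powers (ht : Hauptmodul9 t T) (p : Polynomial ℤ) :
    U3 (fun z => Polynomial.aeval (t z) p) ∈ powers (psi t) := by
  have hone : (1 : ℍ → ℂ) ∈ powers (psi t) := by simpa using pow_mem_powers (psi t) 0
  have hmul : ∀ {g}, g ∈ powers (psi t) → psi t * g ∈ powers (psi t) := fun {g} hg => by
    suffices powers (psi t) ≤ (powers (psi t)).comap (AddMonoidHom.mulLeft (psi t)) from this hg
    refine (AddSubgroup.closure_le _).2 ?_
    rintro _ ⟨k, rfl⟩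
    show psi t * psi t ^ k ∈ powers (psi t)
    rw [← pow_succ']
    exact pow_mem_powers _ _
  have hpow : ∀ j : ℕ, U3 (t ^ j) ∈ powers (psi t) := by
    refine three_term_induction (u := fun j => U3 (t ^ j)) (by simpa [U3_one]) ?_ ?_ fun j e0 _ _ => ?_
    · have h : U3 (t ^ 1) = 0 := by
        ext z
        simp only [U3, pow_one, (ht.third_values z).1, zero_div, Pi.zero_apply]
      rw [h]
      exact AddSubgroup.zero_mem _
    · have h : U3 (t ^ 2) = 0 := by
        ext z
        simp only [U3, Pi.pow_apply, (ht.third_values z).2.1, zero_div, Pi.zero_apply]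
      rw [h]
      exact AddSubgroup.zero_mem _
    · have h : U3 (t ^ (j + 3)) = psi t * U3 (t ^ j) + (27 : ℤ) • U3 (t ^ j) := by
        ext z
        obtain ⟨-, -, h0, h1, h2⟩ := ht.third_values z
        simp only [Pi.add_apply, Pi.mul_apply, Pi.smul_apply, U3, Pi.pow_apply, pow_add, h0, h1, h2]
        simp only [zsmul_eq_mul]
        push_cast
        ring
      show U3 (t ^ (j + 3)) ∈ _
      rw [h]
      exact AddSubgroup.add_mem _ (hmul e0) (AddSubgroup.zsmul_mem _ e0 _)
  induction p using Polynomial.induction_on' with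
  | add p r hp hr =>
    have h := AddSubgroup.add_mem _ hp hr
    rw [← U3Hom_apply, ← U3Hom_apply, ← map_add, U3Hom_apply] at h
    simpa using! h
  | monomial n a =>
    have h := AddSubgroup.zsmul_mem _ (hpow n) a
    rw [← U3Hom_apply, ← map_zsmul, U3Hom_apply] at h
    convert h using 2
    ext z
    simp [Polynomial.aeval_monomial]

lemma U3_iterate_mem_dilate (ht : Hauptmodul9 t T) {n : ℤ} {f : ℍ → ℂ}
    (hf : f ∈ dilate n (tail (ninePhi t))) (k : ℕ) :
    U3^[k] f ∈ dilate (n * 9 ^ k) (tail (ninePhi t)) := by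
  induction k with
  | zero => simpa
  | succ k ih =>
    rw [Function.iterate_succ_apply', pow_succ, ← mul_assoc, ← dilate_dilate]
    exact U3_dilate (fun g => ht.U3_mem_dilate_nine) ih

end Hauptmodul9

section CanonicalBasis

variable {f9 : ℕ → ℍ → ℂ} {a9 : ℕ → ℕ → ℤ}

lemma exists_aeval_canonicalBasis (h9 : ∀ m, IsCanonicalBasis0 9 m (f9 m) (a9 m)) {m : ℕ}
    (hm : m ≠ 0) : ∃ p : Polynomial ℤ, ∀ z, f9 m z = Polynomial.aeval (f9 1 z) p :=
  (h9 1).hauptmodul.exists_aeval m (h9 m).1.sharp9 ((h9 m).qExp hm)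
    (canonicalSeries_mem_intSeries m _) fun n hn => by
      rw [coeff_canonicalSeries_of_nonpos m _ (by omega), if_neg hn.ne]

lemma U3_canonicalBasis_mem_powers (h9 : ∀ m, IsCanonicalBasis0 9 m (f9 m) (a9 m)) {m : ℕ}
    (hm : m ≠ 0) : U3 (f9 m) ∈ powers (psi (f9 1)) := by
  obtain ⟨p, hp⟩ := exists_aeval_canonicalBasis h9 hm
  rw [funext hp]
  exact (h9 1).hauptmodul.U3_aeval_mem_powers p

lemma U3_U3_canonicalBasis_mem (h9 : ∀ m, IsCanonicalBasis0 9 m (f9 m) (a9 m)) {m : ℕ}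
    (hm : ¬ 3 ∣ m) : U3 (U3 (f9 (3 * m))) ∈ dilate 27 (tail (ninePhi (f9 1))) := by
  have hm0 : 3 * m ≠ 0 := by omega
  refine (h9 1).hauptmodul.mem_dilate_of_coeff
    ((h9 1).hauptmodul.U3_powers (U3_canonicalBasis_mem_powers h9 hm0))
    ((h9 _).qExp hm0).U3.U3 fun n hn => ?_
  rw [coeff_decimate, coeff_decimate, coeff_canonicalSeries_of_nonpos _ _ (by omega),
    if_neg (by push_cast; omega)]

lemma U3_U3_canonicalBasis_sub_mem (h9 : ∀ m, IsCanonicalBasis0 9 m (f9 m) (a9 m)) {m : ℕ}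
    (hm : m ≠ 0) :
    U3 (U3 (f9 (3 * (3 * m)))) - U3 (f9 (3 * m)) ∈ dilate 27 (tail (ninePhi (f9 1))) := by
  have hm1 : 3 * m ≠ 0 := by omega
  have hm2 : 3 * (3 * m) ≠ 0 := by omega
  refine (h9 1).hauptmodul.mem_dilate_of_coeff (AddSubgroup.sub_mem _
    ((h9 1).hauptmodul.U3_powers (U3_canonicalBasis_mem_powers h9 hm2))
    (AddSubgroup.mem_sup_left (U3_canonicalBasis_mem_powers h9 hm1)))
    (((h9 _).qExp hm2).U3.U3.sub ((h9 _).qExp hm1).U3) fun n hn => ?_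
  rw [HahnSeries.coeff_sub, coeff_decimate, coeff_decimate, coeff_decimate,
    coeff_canonicalSeries_of_nonpos _ _ (by omega), coeff_canonicalSeries_of_nonpos _ _ (by omega)]
  push_cast
  split_ifs <;> first | omega | simp

lemma U3_iterate_canonicalBasis_mem (h9 : ∀ m, IsCanonicalBasis0 9 m (f9 m) (a9 m)) {m : ℕ}
    (hm : ¬ 3 ∣ m) (i : ℕ) :
    U3^[i + 2] (f9 (3 ^ (i + 1) * m)) ∈ dilate 27 (tail (ninePhi (f9 1))) := by
  induction i with
  | zero => simpa using U3_U3_canonicalBasis_mem h9 hm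
  | succ i ih =>
    have hm0 : 3 ^ i * m ≠ 0 := mul_ne_zero (by simp) (by rintro rfl; simp at hm)
    have h1 := (h9 1).hauptmodul.U3_iterate_mem_dilate (U3_U3_canonicalBasis_sub_mem h9 hm0) (i + 1)
    rw [mul_comm, ← dilate_dilate] at h1
    have h2 := AddSubgroup.add_mem _ (dilate_le _ _ h1) ih
    have h3 : ∀ g : ℍ → ℂ, U3^[i + 1] g = U3Hom^[i + 1] g := fun _ => rfl
    rw [Function.iterate_succ_apply (n := i + 1), h3, h3, ← mul_assoc 3 (3 ^ i), ← pow_succ',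
      ← mul_assoc 3, ← pow_succ', ← iterate_map_add, sub_add_cancel] at h2
    exact h2

lemma dvd_coeff_of_lt (h9 : ∀ m, IsCanonicalBasis0 9 m (f9 m) (a9 m)) {m n α β : ℕ}
    (hm : ¬ 3 ∣ m) (hn : n ≠ 0) (h : α < β) :
    (3 : ℤ) ^ (2 * (β - α) + 3) ∣ a9 (3 ^ α * m) (3 ^ β * n) := by
  have hm0 : m ≠ 0 := by rintro rfl; simp at hm
  rcases α with _ | i
  · have h3 : 3 ∣ 3 ^ β * n := Dvd.dvd.mul_right (dvd_pow_self 3 h.ne') n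
    rw [(h9 _).coeff_eq_zero (by simpa) (by simpa) (by rwa [pow_zero, one_mul, Nat.dvd_add_left h3])]
    exact dvd_zero _
  · obtain ⟨k, rfl⟩ := Nat.exists_eq_add_of_lt h
    have h1 := (h9 1).hauptmodul.U3_iterate_mem_dilate (U3_iterate_canonicalBasis_mem h9 hm i) k
    have h2 := ((h9 (3 ^ (i + 1) * m)).qExp (by simpa)).U3_iterate (i + 1 + k + 1)
    rw [show i + 1 + k + 1 = k + (i + 2) by ring, Function.iterate_add_apply] at h2
    obtain ⟨c, hc⟩ := ((h9 1).hauptmodul.exists_coeff_of_mem_dilate h1 h2).2 n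
    have h3 := coeff_canonicalSeries_nat (3 ^ (i + 1) * m) (a9 (3 ^ (i + 1) * m))
      (n := 3 ^ (k + (i + 2)) * n) (by simpa)
    rw [coeff_decimate_iterate] at hc
    push_cast at h3 hc
    rw [h3] at hc
    rw [show i + 1 + k + 1 = k + (i + 2) by ring]
    refine ⟨c, ?_⟩
    have h4 : a9 (3 ^ (i + 1) * m) (3 ^ (k + (i + 2)) * n) = 27 * 9 ^ k * 9 * c := by exact_mod_cast hc
    rw [h4, show 2 * (k + (i + 2) - (i + 1)) + 3 = 2 * k + 5 by omega, pow_add, pow_mul]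
    norm_num only
    ring

/-- Zagier-type duality for the coefficients of the canonical basis. -/
lemma canonicalBasis_duality (h9 : ∀ m, IsCanonicalBasis0 9 m (f9 m) (a9 m)) {m n : ℕ}
    (hm : m ≠ 0) (hn : n ≠ 0) : n * a9 m n = m * a9 n m := by
  have hm' : ∀ m, m ≠ 0 → ∃ p : Polynomial ℤ,
      canonicalSeries m (a9 m) = Polynomial.aeval (canonicalSeries 1 (a9 1)) p := fun m hm => by
    obtain ⟨p, hp⟩ := exists_aeval_canonicalBasis h9 hm
    exact ⟨p, ((h9 m).qExp hm).unique ((((h9 1).qExp one_ne_zero).aeval p).congr hp rfl)⟩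
  obtain ⟨p, hp⟩ := hm' m hm
  obtain ⟨r, hr⟩ := hm' n hn
  have h := coeff_zero_aeval_mul_thetaD_aeval (canonicalSeries 1 (a9 1)) p r
  rw [← hp, ← hr] at h
  set A := canonicalSeries m (a9 m)
  set B := canonicalSeries n (a9 n)
  set P := A - HahnSeries.single (-m : ℤ) 1 with hP
  set Q := thetaD B - HahnSeries.single (-n : ℤ) (-n : ℂ) with hQ
  have hA : ∀ k ≤ 0, A.coeff k = _ := fun k hk => coeff_canonicalSeries_of_nonpos m (a9 m) hk
  have hB : ∀ k ≤ 0, B.coeff k = _ := fun k hk => coeff_canonicalSeries_of_nonpos n (a9 n) hk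
  have hP0 : ∀ k < 1, P.coeff k = 0 := fun k hk => by
    rw [HahnSeries.coeff_sub, hA k (by omega), HahnSeries.coeff_single]
    split_ifs <;> simp
  have hQ0 : ∀ k < 1, Q.coeff k = 0 := fun k hk => by
    rw [HahnSeries.coeff_sub, coeff_thetaD, hB k (by omega), HahnSeries.coeff_single]
    split_ifs with hk
    · simp [hk]
    · simp
  have hAB : A * thetaD B = HahnSeries.single (-m : ℤ) 1 * thetaD B +
      (HahnSeries.single (-n : ℤ) (-n : ℂ) * P + P * Q) := by
    rw [hP, hQ]
    ring
  rw [hAB, HahnSeries.coeff_add, HahnSeries.coeff_add, HahnSeries.coeff_single_mul,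
    HahnSeries.coeff_single_mul, coeff_mul_eq_zero hP0 hQ0 0 (by norm_num), hP, HahnSeries.coeff_sub,
    coeff_thetaD, HahnSeries.coeff_single_of_ne (by omega), zero_sub, zero_sub, neg_neg, neg_neg,
    coeff_canonicalSeries_nat m _ hn, coeff_canonicalSeries_nat n _ hm] at h
  push_cast at h
  have h' : (n : ℂ) * a9 m n = m * a9 n m := by linear_combination -h
  exact_mod_cast h'

lemma dvd_coeff_of_gt (h9 : ∀ m, IsCanonicalBasis0 9 m (f9 m) (a9 m)) {m n α β : ℕ}
    (hm : m ≠ 0) (hn : ¬ 3 ∣ n) (h : β < α) :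
    (3 : ℤ) ^ (3 * (α - β) + 3) ∣ a9 (3 ^ α * m) (3 ^ β * n) := by
  have hn0 : n ≠ 0 := by rintro rfl; simp at hn
  obtain ⟨k, rfl⟩ := Nat.exists_eq_add_of_lt h
  obtain ⟨c, hc⟩ := dvd_coeff_of_lt h9 hn hm h
  have hd := canonicalBasis_duality h9 (m := 3 ^ (β + k + 1) * m) (n := 3 ^ β * n)
    (by simpa) (by simpa)
  rw [hc, show β + k + 1 - β = k + 1 by omega] at hd
  rw [show β + k + 1 - β = k + 1 by omega]
  have hcop : IsCoprime ((3 : ℤ) ^ (3 * (k + 1) + 3)) n := by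
    refine IsCoprime.pow_left ?_
    exact_mod_cast Nat.isCoprime_iff_coprime.2 ((Nat.prime_three.coprime_iff_not_dvd).2 hn)
  refine hcop.dvd_of_dvd_mul_left ⟨m * c, ?_⟩
  refine mul_left_cancel₀ (pow_ne_zero β (three_ne_zero (α := ℤ))) ?_
  push_cast at hd
  rw [← mul_assoc, hd]
  ring

end CanonicalBasis

/-- Divisibility of `a₀⁽⁹⁾(3^α m', 3^β n')` by powers of 3 when `α ≠ β`. -/
theorem congruences_level9 (f9 : ℕ → ℍ → ℂ) (a9 : ℕ → ℕ → ℤ)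
    (h9 : ∀ m, IsCanonicalBasis0 9 m (f9 m) (a9 m)) :
    ∀ α β m' n' : ℕ, ¬ 3 ∣ m' → ¬ 3 ∣ n' →
      (β < α → (3 : ℤ) ^ (3 * (α - β) + 3) ∣ a9 (3 ^ α * m') (3 ^ β * n')) ∧
      (α < β → (3 : ℤ) ^ (2 * (β - α) + 3) ∣ a9 (3 ^ α * m') (3 ^ β * n')) :=
  fun _ _ _ _ hm hn => ⟨dvd_coeff_of_gt h9 (by rintro rfl; simp at hm) hn,
    dvd_coeff_of_lt h9 hm (by rintro rfl; simp at hn)⟩
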